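/- There exists an absolute constant C ∈ (0,∞) such that for all n ∈ ℕ and all p ∈ [1,∞), the total variation distance between the surface probability measure σ_p^n and the cone probability measure μ_p^n on 𝕊_p^{n-1} satisfies d_TV(σ_p^n, μ_p^n) := sup{|σ_p^n(A) − μ_p^n(A)| : A Borel ⊆ 𝕊_p^{n-1}} ≤ C (1 − 1/p) |1 − 2/p| √(np)/(n+p). -/

import Mathlib

open MeasureTheory Set
open scoped ENNReal

/-- The `p`-norm on the Euclidean space `ℝ^n`. -/
noncomputable def pnorm {n : ℕ} (p : ℝ) (x : EuclideanSpace ℝ (Fin n)) : ℝ :=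
  (∑ i, |x i| ^ p) ^ (1 / p)

/-- The unit ball `𝔹_p^n` of the `p`-norm. -/
def pBall (n : ℕ) (p : ℝ) : Set (EuclideanSpace ℝ (Fin n)) := {x | pnorm p x ≤ 1}

/-- The unit sphere `𝕊_p^{n-1}` of the `p`-norm. -/
def pSphere (n : ℕ) (p : ℝ) : Set (EuclideanSpace ℝ (Fin n)) := {x | pnorm p x = 1}

/-- The cone `[0,1]A = {r • a : r ∈ [0,1], a ∈ A}`. -/
def coneSet {n : ℕ} (A : Set (EuclideanSpace ℝ (Fin n))) : Set (EuclideanSpace ℝ (Fin n)) :=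
  Set.image2 (· • ·) (Icc (0 : ℝ) 1) A

/-- The cone probability measure of a Borel set `A ⊆ 𝕊_p^{n-1}`:
`μ_p^n(A) = |[0,1]A| / |𝔹_p^n|`. -/
noncomputable def coneMeasureSet (n : ℕ) (p : ℝ) (A : Set (EuclideanSpace ℝ (Fin n))) : ℝ :=
  (volume (coneSet A) / volume (pBall n p)).toReal

/-- The surface probability measure of a Borel set `A ⊆ 𝕊_p^{n-1}`: the normalized
`(n-1)`-dimensional Hausdorff measure. -/
noncomputable def surfaceMeasureSet (n : ℕ) (p : ℝ) (A : Set (EuclideanSpace ℝ (Fin n))) : ℝ :=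
  (μH[(n : ℝ) - 1] A / μH[(n : ℝ) - 1] (pSphere n p)).toReal

lemma integrableOn_rpow_mul_gamma {s r : ℝ} (h : 0 < s + r) :
    IntegrableOn (fun t : ℝ => t ^ r * (Real.exp (-t) * t ^ (s - 1))) (Ioi 0) := by
  refine (Real.GammaIntegral_convergent h).congr_fun (fun t ht => ?_) measurableSet_Ioi
  simp only
  rw [show s + r - 1 = r + (s - 1) by ring, Real.rpow_add ht]
  ring

lemma integral_rpow_mul_gamma {s r : ℝ} (h : 0 < s + r) :
    ∫ t in Ioi (0 : ℝ), t ^ r * (Real.exp (-t) * t ^ (s - 1)) = Real.Gamma (s + r) := by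
  rw [Real.Gamma_eq_integral h]
  refine setIntegral_congr_fun measurableSet_Ioi (fun t ht => ?_)
  rw [show s + r - 1 = r + (s - 1) by ring, Real.rpow_add ht]
  ring

/-- The second moment of `A t ^ q + B t + D` with respect to the unnormalized Gamma density. -/
lemma hasIntegral_sq_gamma {s q : ℝ} (A B D : ℝ) (hs : 0 < s) (hq : 0 ≤ q) :
    IntegrableOn (fun t : ℝ => (A * t ^ q + B * t + D) ^ 2 * (Real.exp (-t) * t ^ (s - 1)))
      (Ioi 0) ∧
    ∫ t in Ioi (0 : ℝ), (A * t ^ q + B * t + D) ^ 2 * (Real.exp (-t) * t ^ (s - 1)) =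
      A ^ 2 * Real.Gamma (s + 2 * q) + B ^ 2 * (s * (s + 1) * Real.Gamma s) +
        D ^ 2 * Real.Gamma s + 2 * A * B * ((s + q) * Real.Gamma (s + q)) +
        2 * A * D * Real.Gamma (s + q) + 2 * B * D * (s * Real.Gamma s) := by
  have e : EqOn (fun t : ℝ => (A * t ^ q + B * t + D) ^ 2 * (Real.exp (-t) * t ^ (s - 1)))
      (fun t => A ^ 2 * (t ^ (2 * q) * (Real.exp (-t) * t ^ (s - 1))) +
        B ^ 2 * (t ^ (2 : ℝ) * (Real.exp (-t) * t ^ (s - 1))) +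
        D ^ 2 * (t ^ (0 : ℝ) * (Real.exp (-t) * t ^ (s - 1))) +
        2 * A * B * (t ^ (q + 1) * (Real.exp (-t) * t ^ (s - 1))) +
        2 * A * D * (t ^ q * (Real.exp (-t) * t ^ (s - 1))) +
        2 * B * D * (t ^ (1 : ℝ) * (Real.exp (-t) * t ^ (s - 1)))) (Ioi 0) := by
    intro t ht
    have ht : 0 < t := ht
    simp only
    rw [show t ^ (2 * q) = t ^ q * t ^ q by rw [two_mul, Real.rpow_add ht],
      Real.rpow_add ht q 1, Real.rpow_one, Real.rpow_zero, Real.rpow_two]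
    ring
  have I : ∀ (c r : ℝ), 0 ≤ r → Integrable (fun t : ℝ => c * (t ^ r * (Real.exp (-t) * t ^ (s - 1))))
      (volume.restrict (Ioi 0)) := fun c r hr =>
    Integrable.const_mul (integrableOn_rpow_mul_gamma (by linarith)) c
  have J1 := I (A ^ 2) (2 * q) (by positivity)
  have J2 := I (B ^ 2) 2 (by positivity)
  have J3 := I (D ^ 2) 0 le_rfl
  have J4 := I (2 * A * B) (q + 1) (by positivity)
  have J5 := I (2 * A * D) q hq
  have J6 := I (2 * B * D) 1 (by positivity)
  constructor
  · exact IntegrableOn.congr_fun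
      (((((J1.add J2).add J3).add J4).add J5).add J6) e.symm measurableSet_Ioi
  · rw [setIntegral_congr_fun measurableSet_Ioi e, integral_add, integral_add, integral_add,
      integral_add, integral_add]
    · simp only [integral_const_mul]
      rw [integral_rpow_mul_gamma (by positivity), integral_rpow_mul_gamma (by positivity),
        integral_rpow_mul_gamma (by positivity), integral_rpow_mul_gamma (by positivity),
        integral_rpow_mul_gamma (by positivity), integral_rpow_mul_gamma (by positivity),
        ← add_assoc, Real.Gamma_add_one (by positivity), add_zero, Real.Gamma_add_one hs.ne',
        show s + 2 = (s + 1) + 1 by ring, Real.Gamma_add_one (by positivity),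
        Real.Gamma_add_one hs.ne']
      ring
    all_goals first
      | exact J1 | exact J2 | exact J3 | exact J4 | exact J5 | exact J6
      | exact J1.add J2 | exact (J1.add J2).add J3
      | exact ((J1.add J2).add J3).add J4
      | exact (((J1.add J2).add J3).add J4).add J5

lemma Gamma_cauchy_schwarz {s q : ℝ} (hs : 0 < s) (hq : 0 ≤ q) :
    Real.Gamma (s + q) ^ 2 * (1 + q ^ 2 / s) ≤ Real.Gamma (s + 2 * q) * Real.Gamma s := by
  have g0 := Real.Gamma_pos_of_pos hs
  set m := Real.Gamma (s + q) / Real.Gamma s with hm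
  have hg1 : Real.Gamma (s + q) = m * Real.Gamma s := by rw [hm]; field_simp
  have h := (hasIntegral_sq_gamma 1 (-(q * m / s)) ((q - 1) * m) hs hq).2
  have h0 : 0 ≤ ∫ t in Ioi (0 : ℝ), (1 * t ^ q + (-(q * m / s)) * t + ((q - 1) * m)) ^ 2 *
      (Real.exp (-t) * t ^ (s - 1)) :=
    setIntegral_nonneg measurableSet_Ioi fun t (ht : 0 < t) => by positivity
  rw [h, hg1] at h0
  rw [hg1]
  have key : 0 ≤ Real.Gamma (s + 2 * q) - m ^ 2 * (1 + q ^ 2 / s) * Real.Gamma s := by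
    convert h0 using 1
    field_simp
    ring
  nlinarith

lemma Gamma_le_inv {a : ℝ} (ha : 0 < a) (ha1 : a ≤ 1) : Real.Gamma a ≤ 1 / a := by
  have h := Real.convexOn_Gamma.2 (show (1 : ℝ) ∈ Ioi 0 by norm_num)
    (show (2 : ℝ) ∈ Ioi 0 by norm_num) (show 0 ≤ 1 - a by linarith) ha.le (by ring)
  simp only [smul_eq_mul, Real.Gamma_one, Real.Gamma_two] at h
  rw [show (1 - a) * 1 + a * 2 = a + 1 by ring, Real.Gamma_add_one ha.ne'] at h
  rw [le_div_iff₀ ha]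
  linarith

lemma half_le_Gamma {x : ℝ} (hx : 1 ≤ x) (hx2 : x ≤ 2) : 1 / 2 ≤ Real.Gamma x := by
  have hx0 : 0 < x := by linarith
  rcases hx2.eq_or_lt with rfl | hlt
  · rw [Real.Gamma_two]; norm_num
  have h := Real.convexOn_log_Gamma.slope_mono_adjacent (x := x) (y := 2) (z := 3)
    hx0 (by norm_num) hlt (by norm_num)
  have h3 : Real.Gamma 3 = 2 := by
    rw [show (3 : ℝ) = 2 + 1 by norm_num, Real.Gamma_add_one (by norm_num), Real.Gamma_two]
    norm_num
  simp only [Function.comp, Real.Gamma_two, h3, Real.log_one] at h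
  rw [div_le_iff₀ (by linarith)] at h
  have hl : 0 < Real.log 2 := Real.log_pos (by norm_num)
  have : Real.log (1 / 2) ≤ Real.log (Real.Gamma x) := by
    rw [one_div, Real.log_inv]; nlinarith
  exact (Real.log_le_log_iff (by norm_num) (Real.Gamma_pos_of_pos hx0)).1 this

lemma Gamma_mono_two {x y : ℝ} (hx : 2 ≤ x) (h : x ≤ y) : Real.Gamma x ≤ Real.Gamma y :=
  Real.Gamma_strictMonoOn_Ici.monotoneOn hx (hx.trans h) h

lemma abs_rpow_sub_affine_le {t q : ℝ} (ht : 0 < t) (hq : 0 ≤ q) (hq2 : q ≤ 3 / 2) :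
    |t ^ q - q * t + (q - 1)| ≤ 2 * (q * |q - 1|) * (t ^ 2 + 1 + 16 * t ^ (-(1 / 16 : ℝ))) := by
  have hlog : Real.log t ≤ t - 1 := Real.log_le_sub_one_of_pos ht
  have hK : 0 < t ^ (-(1 / 16 : ℝ)) := by positivity
  have hlog' : -Real.log t ≤ 16 * t ^ (-(1 / 16 : ℝ)) := by
    have := Real.log_le_sub_one_of_pos hK
    rw [Real.log_rpow ht] at this
    linarith
  set K := t ^ 2 + 1 + 16 * t ^ (-(1 / 16 : ℝ)) with hKdef
  have hKpos : 0 < K := by positivity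
  have hexp : t ^ q = Real.exp (Real.log t * q) := Real.rpow_def_of_pos ht q
  rcases le_total q 1 with h1 | h1
  · have lo0 : 1 + q * Real.log t ≤ t ^ q := by
      rw [hexp]; linarith [Real.add_one_le_exp (Real.log t * q)]
    have lo1 : t * (1 + (q - 1) * Real.log t) ≤ t ^ q := by
      have : t ^ q = t * Real.exp (Real.log t * (q - 1)) := by
        rw [← Real.rpow_def_of_pos ht, Real.rpow_sub_one ht.ne']
        field_simp
      rw [this]
      gcongr
      linarith [Real.add_one_le_exp (Real.log t * (q - 1))]
    have up : t ^ q ≤ 1 + q * (t - 1) := by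
      have := rpow_one_add_le_one_add_mul_self (s := t - 1) (by linarith) hq h1
      simpa using this
    rw [abs_of_nonpos (by linarith), abs_of_nonpos (show q - 1 ≤ 0 by linarith)]
    have b0 : -(t ^ q - q * t + (q - 1)) ≤ q * K := by
      have : t - 1 - Real.log t ≤ K := by nlinarith [sq_nonneg (t - 1)]
      nlinarith
    have b1 : -(t ^ q - q * t + (q - 1)) ≤ (1 - q) * K := by
      have : t * Real.log t - t + 1 ≤ K := by nlinarith [sq_nonneg (t - 1)]
      nlinarith
    rcases le_total q (1 / 2) with h2 | h2
    · nlinarith [mul_nonneg hq hKpos.le]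
    · nlinarith [mul_nonneg (sub_nonneg.2 h1) hKpos.le]
  · have lo : 1 + q * (t - 1) ≤ t ^ q := by
      have := one_add_mul_self_le_rpow_one_add (s := t - 1) (by linarith) h1
      simpa using this
    have up : t ^ q ≤ (2 - q) * t + (q - 1) * t ^ 2 := by
      have := Real.geom_mean_le_arith_mean2_weighted (show 0 ≤ 2 - q by linarith)
        (show 0 ≤ q - 1 by linarith) ht.le (sq_nonneg t) (by ring)
      refine le_trans (le_of_eq ?_) this
      rw [← Real.rpow_two, ← Real.rpow_mul ht.le, ← Real.rpow_add ht]
      ring_nf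
    rw [abs_of_nonneg (by linarith), abs_of_nonneg (show 0 ≤ q - 1 by linarith)]
    have : (t - 1) ^ 2 ≤ K := by nlinarith
    have h3 : t ^ q - q * t + (q - 1) ≤ (q - 1) * K := by nlinarith
    nlinarith [mul_nonneg (sub_nonneg.2 h1) hKpos.le]

lemma Gamma_excess_le {a : ℝ} (ha : 1 / 4 ≤ a) (ha1 : a ≤ 1) :
    Real.Gamma (a + 2 * (2 - 2 * a)) * Real.Gamma a -
        Real.Gamma (a + (2 - 2 * a)) ^ 2 * (1 + (2 - 2 * a) ^ 2 / a) ≤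
      400000 * ((2 - 2 * a) ^ 2 * (1 - 2 * a) ^ 2) * Real.Gamma (a + (2 - 2 * a)) ^ 2 := by
  have ha0 : 0 < a := by linarith
  set q := 2 - 2 * a with hqd
  have hq : 0 ≤ q := by linarith
  have hq2 : q ≤ 3 / 2 := by linarith
  have g0 := Real.Gamma_pos_of_pos ha0
  have hg0 : Real.Gamma a ≤ 4 := (Gamma_le_inv ha0 ha1).trans (by
    rw [div_le_iff₀ ha0]; linarith)
  have hg8 : Real.Gamma (a - 1 / 8) ≤ 8 := (Gamma_le_inv (by linarith) (by linarith)).trans (by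
    rw [div_le_iff₀ (by linarith)]; linarith)
  have hg4 : Real.Gamma (a + 4) ≤ 24 := by
    refine (Gamma_mono_two (y := 5) (by linarith) (by linarith)).trans (le_of_eq ?_)
    rw [show (5 : ℝ) = ((4 : ℕ) : ℝ) + 1 by norm_num, Real.Gamma_nat_eq_factorial]
    norm_num [Nat.factorial]
  have hg1 : 1 / 2 ≤ Real.Gamma (a + q) := half_le_Gamma (by linarith) (by linarith)
  set m := Real.Gamma (a + q) / Real.Gamma a with hm
  have hgm : Real.Gamma (a + q) = m * Real.Gamma a := by rw [hm]; field_simp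
  obtain ⟨hi, h⟩ := hasIntegral_sq_gamma 1 (-q) (q - 1) ha0 hq
  have hle : ∫ t in Ioi (0 : ℝ), (1 * t ^ q + (-q) * t + (q - 1)) ^ 2 *
      (Real.exp (-t) * t ^ (a - 1)) ≤
      4 * (q ^ 2 * (q - 1) ^ 2) * (3 * 2076) := by
    have I4 := (integrableOn_rpow_mul_gamma (s := a) (r := 4) (by linarith)).const_mul
      (4 * (q ^ 2 * (q - 1) ^ 2) * 3)
    have I0 := (integrableOn_rpow_mul_gamma (s := a) (r := 0) (by linarith)).const_mul
      (4 * (q ^ 2 * (q - 1) ^ 2) * 3)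
    have I8 := (integrableOn_rpow_mul_gamma (s := a) (r := -(1 / 8)) (by linarith)).const_mul
      (4 * (q ^ 2 * (q - 1) ^ 2) * 3 * 256)
    have : ∫ t in Ioi (0 : ℝ), (1 * t ^ q + (-q) * t + (q - 1)) ^ 2 *
      (Real.exp (-t) * t ^ (a - 1)) ≤ ∫ t in Ioi (0 : ℝ),
        ((4 * (q ^ 2 * (q - 1) ^ 2) * 3 * (t ^ (4 : ℝ) * (Real.exp (-t) * t ^ (a - 1))) +
        4 * (q ^ 2 * (q - 1) ^ 2) * 3 * (t ^ (0 : ℝ) * (Real.exp (-t) * t ^ (a - 1)))) +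
        4 * (q ^ 2 * (q - 1) ^ 2) * 3 * 256 *
          (t ^ (-(1 / 8 : ℝ)) * (Real.exp (-t) * t ^ (a - 1)))) := by
      refine setIntegral_mono_on hi ((I4.add I0).add I8) measurableSet_Ioi fun t ht => ?_
      have ht : 0 < t := ht
      have hu := abs_rpow_sub_affine_le ht hq hq2
      have hu2 := pow_le_pow_left₀ (abs_nonneg _) hu 2
      rw [sq_abs, mul_pow, mul_pow, mul_pow, sq_abs] at hu2
      have e8 : t ^ (-(1 / 8 : ℝ)) = (t ^ (-(1 / 16 : ℝ))) ^ 2 := by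
        rw [← Real.rpow_natCast, ← Real.rpow_mul ht.le]; norm_num
      have e4 : t ^ (4 : ℝ) = (t ^ 2) ^ 2 := by
        rw [← pow_mul, ← Real.rpow_natCast]; norm_num
      rw [e8, e4, Real.rpow_zero]
      set y := t ^ (-(1 / 16 : ℝ))
      set x := t ^ 2
      have hw : 0 ≤ Real.exp (-t) * t ^ (a - 1) := by positivity
      have h3 : (x + 1 + 16 * y) ^ 2 ≤ 3 * (x ^ 2 + 1 + 256 * y ^ 2) := by
        nlinarith [sq_nonneg (x - 1), sq_nonneg (x - 16 * y), sq_nonneg (1 - 16 * y)]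
      have h4 : (1 * t ^ q + -q * t + (q - 1)) ^ 2 ≤
          4 * (q ^ 2 * (q - 1) ^ 2) * (3 * (x ^ 2 + 1 + 256 * y ^ 2)) := by
        calc _ = (t ^ q - q * t + (q - 1)) ^ 2 := by ring
          _ ≤ _ := hu2
          _ = 4 * (q ^ 2 * (q - 1) ^ 2) * (x + 1 + 16 * y) ^ 2 := by ring
          _ ≤ _ := by gcongr
      calc _ ≤ _ := mul_le_mul_of_nonneg_right h4 hw
        _ = _ := by ring
    refine this.trans ?_
    rw [integral_add (by exact I4.add I0) I8, integral_add I4 I0]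
    simp only [integral_const_mul]
    rw [integral_rpow_mul_gamma (by linarith), integral_rpow_mul_gamma (by linarith),
      integral_rpow_mul_gamma (by linarith), add_zero, ← sub_eq_add_neg]
    have : 0 ≤ 4 * (q ^ 2 * (q - 1) ^ 2) * 3 := by positivity
    nlinarith
  rw [h] at hle
  have hq1 : (1 - 2 * a) = q - 1 := by rw [hqd]; ring
  rw [hq1]
  have key : Real.Gamma (a + 2 * q) - m ^ 2 * (1 + q ^ 2 / a) * Real.Gamma a ≤
      4 * (q ^ 2 * (q - 1) ^ 2) * (3 * 2076) := by
    refine le_trans ?_ hle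
    rw [hgm, ← sub_nonneg]
    have : 0 ≤ (q ^ 2 * (m - a) ^ 2 / a + (m - q * a + q - 1) ^ 2) * Real.Gamma a := by positivity
    refine this.trans (le_of_eq ?_)
    generalize Real.Gamma (a + 2 * q) = G2
    generalize Real.Gamma a = G
    field_simp
    ring
  have hQ : 0 ≤ q ^ 2 * (q - 1) ^ 2 := by positivity
  have hg12 : 1 / 4 ≤ Real.Gamma (a + q) ^ 2 := by nlinarith
  calc Real.Gamma (a + 2 * q) * Real.Gamma a - Real.Gamma (a + q) ^ 2 * (1 + q ^ 2 / a)
      = (Real.Gamma (a + 2 * q) - m ^ 2 * (1 + q ^ 2 / a) * Real.Gamma a) * Real.Gamma a := by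
        rw [hgm]; ring
    _ ≤ 4 * (q ^ 2 * (q - 1) ^ 2) * (3 * 2076) * 4 := by
        refine (mul_le_mul_of_nonneg_right key g0.le).trans ?_
        gcongr
    _ ≤ 400000 * (q ^ 2 * (q - 1) ^ 2) * (1 / 4) := by nlinarith
    _ ≤ _ := by gcongr

lemma moment_ratio_le {n a q M0 M1 M2 : ℝ} (hn : 1 ≤ n) (ha : 0 < a) (hq : 0 ≤ q)
    (h1 : M1 = M0 * (n * (Real.Gamma (a + q) / Real.Gamma a)) *
      (Real.Gamma (n * a) / Real.Gamma (n * a + q)))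
    (h2 : M2 = M0 * (n * (Real.Gamma (a + 2 * q) / Real.Gamma a -
      (Real.Gamma (a + q) / Real.Gamma a) ^ 2) +
      n ^ 2 * (Real.Gamma (a + q) / Real.Gamma a) ^ 2) *
      (Real.Gamma (n * a) / Real.Gamma (n * a + 2 * q))) :
    M2 * M0 - M1 ^ 2 ≤ M1 ^ 2 * ((Real.Gamma (a + 2 * q) * Real.Gamma a -
      Real.Gamma (a + q) ^ 2 * (1 + q ^ 2 / a)) / Real.Gamma (a + q) ^ 2 / n) := by
  have hn0 : 0 < n := by linarith
  have hs : 0 < n * a := by positivity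
  have g0 := Real.Gamma_pos_of_pos ha
  have g1 := Real.Gamma_pos_of_pos (show 0 < a + q by positivity)
  have g2 := Real.Gamma_pos_of_pos (show 0 < a + 2 * q by positivity)
  have s0 := Real.Gamma_pos_of_pos hs
  have s1 := Real.Gamma_pos_of_pos (show 0 < n * a + q by positivity)
  have s2 := Real.Gamma_pos_of_pos (show 0 < n * a + 2 * q by positivity)
  have c1 := Gamma_cauchy_schwarz ha hq
  have c2 := Gamma_cauchy_schwarz hs hq
  generalize Real.Gamma a = G0 at *
  generalize Real.Gamma (a + q) = G1 at *
  generalize Real.Gamma (a + 2 * q) = G2 at *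
  generalize Real.Gamma (n * a) = S0 at *
  generalize Real.Gamma (n * a + q) = S1 at *
  generalize Real.Gamma (n * a + 2 * q) = S2 at *
  set D := (G2 * G0 - G1 ^ 2 * (1 + q ^ 2 / a)) / G1 ^ 2 with hD
  have hD0 : 0 ≤ D := by rw [hD]; exact div_nonneg (by linarith) (by positivity)
  have hG2 : G2 = G1 ^ 2 * (1 + q ^ 2 / a + D) / G0 := by
    rw [hD]; field_simp; ring
  have key : (1 + q ^ 2 / (n * a) + D / n) * (S0 / S2) ≤ (S0 / S1) ^ 2 * (1 + D / n) := by
    have e1 : (1 + q ^ 2 / (n * a)) * (S0 / S2) ≤ (S0 / S1) ^ 2 := by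
      rw [div_pow, mul_div_assoc', div_le_div_iff₀ s2 (by positivity)]
      nlinarith
    have e2 : 1 + q ^ 2 / (n * a) + D / n ≤ (1 + q ^ 2 / (n * a)) * (1 + D / n) := by
      have : 0 ≤ q ^ 2 / (n * a) * (D / n) := by positivity
      nlinarith
    calc _ ≤ (1 + q ^ 2 / (n * a)) * (1 + D / n) * (S0 / S2) := by gcongr
      _ = (1 + q ^ 2 / (n * a)) * (S0 / S2) * (1 + D / n) := by ring
      _ ≤ _ := by gcongr
  have hM2 : M2 * M0 = (M0 * (n * (G1 / G0))) ^ 2 *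
      ((1 + q ^ 2 / (n * a) + D / n) * (S0 / S2)) := by
    rw [h2, hG2]; field_simp; ring
  rw [sub_le_iff_le_add, hM2]
  calc _ ≤ (M0 * (n * (G1 / G0))) ^ 2 * ((S0 / S1) ^ 2 * (1 + D / n)) := by gcongr
    _ = _ := by rw [h1]; ring

lemma moment_ratio_le_uniform {n a M0 M1 M2 : ℝ} (hn : 1 ≤ n) (ha : 0 < a) (ha1 : a ≤ 1)
    (hM0 : 0 < M0)
    (h1 : M1 = M0 * (n * (Real.Gamma (a + (2 - 2 * a)) / Real.Gamma a)) *
      (Real.Gamma (n * a) / Real.Gamma (n * a + (2 - 2 * a))))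
    (h2 : M2 = M0 * (n * (Real.Gamma (a + 2 * (2 - 2 * a)) / Real.Gamma a -
      (Real.Gamma (a + (2 - 2 * a)) / Real.Gamma a) ^ 2) +
      n ^ 2 * (Real.Gamma (a + (2 - 2 * a)) / Real.Gamma a) ^ 2) *
      (Real.Gamma (n * a) / Real.Gamma (n * a + 2 * (2 - 2 * a))))
    (h3 : a ≤ 1 / 2 → M2 ≤ M1) (h4 : a ≤ 1 / 2 → M0 ≤ (1 + n * a) * M1) :
    M2 * M0 - M1 ^ 2 ≤
      10000000 * ((2 - 2 * a) ^ 2 * (1 - 2 * a) ^ 2) * (n * a / (1 + n * a) ^ 2) * M1 ^ 2 := by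
  have hn0 : 0 < n := by linarith
  have hs : 0 < n * a := by positivity
  have hM1 : 0 < M1 := by
    rw [h1]
    have g0 := Real.Gamma_pos_of_pos ha
    have g1 := Real.Gamma_pos_of_pos (show 0 < a + (2 - 2 * a) by linarith)
    have s0 := Real.Gamma_pos_of_pos hs
    have s1 := Real.Gamma_pos_of_pos (show 0 < n * a + (2 - 2 * a) by linarith)
    positivity
  have gen := moment_ratio_le hn ha (by linarith) h1 h2
  have hM12 : 0 < M1 ^ 2 := by positivity
  have hg1 : 1 / 2 ≤ Real.Gamma (a + (2 - 2 * a)) := half_le_Gamma (by linarith) (by linarith)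
  have hg12 : 0 < Real.Gamma (a + (2 - 2 * a)) ^ 2 := by positivity
  have hQ : 0 ≤ (2 - 2 * a) ^ 2 * (1 - 2 * a) ^ 2 := by positivity
  have hS : 0 < n * a / (1 + n * a) ^ 2 := by positivity
  rcases le_total a (1 / 4) with h | h
  · have hQ2 : 9 / 16 ≤ (2 - 2 * a) ^ 2 * (1 - 2 * a) ^ 2 := by
      have e1 : 9 / 4 ≤ (2 - 2 * a) ^ 2 := by nlinarith
      have e2 : 1 / 4 ≤ (1 - 2 * a) ^ 2 := by nlinarith
      nlinarith
    suffices M2 * M0 - M1 ^ 2 ≤ 100 * (n * a / (1 + n * a) ^ 2) * M1 ^ 2 by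
      refine this.trans ?_
      gcongr
      nlinarith
    rcases le_total (n * a) 1 with hs1 | hs1
    · have hS2 : n * a / 4 ≤ n * a / (1 + n * a) ^ 2 := by
        gcongr
        nlinarith
      have h3 := h3 (by linarith)
      have h4 := h4 (by linarith)
      have : M2 * M0 - M1 ^ 2 ≤ n * a * M1 ^ 2 := by
        have : M2 * M0 ≤ M1 * ((1 + n * a) * M1) :=
          mul_le_mul h3 h4 hM0.le hM1.le
        linarith
      exact this.trans (mul_le_mul_of_nonneg_right (by linarith) hM12.le)
    · have hS2 : 1 / (4 * (n * a)) ≤ n * a / (1 + n * a) ^ 2 := by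
        rw [div_le_div_iff₀ (by positivity) (by positivity)]
        nlinarith
      refine gen.trans ?_
      rw [mul_comm]
      gcongr
      refine le_trans ?_ (mul_le_mul_of_nonneg_left hS2 (by norm_num))
      rw [div_div, div_le_iff₀ (by positivity)]
      have hG2 : Real.Gamma (a + 2 * (2 - 2 * a)) ≤ 6 := by
        refine (Gamma_mono_two (y := 4) (by linarith) (by linarith)).trans (le_of_eq ?_)
        rw [show (4 : ℝ) = ((3 : ℕ) : ℝ) + 1 by norm_num, Real.Gamma_nat_eq_factorial]
        norm_num [Nat.factorial]
      have hG0 := Gamma_le_inv ha ha1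
      have hG0' := Real.Gamma_pos_of_pos ha
      have : Real.Gamma (a + 2 * (2 - 2 * a)) * Real.Gamma a ≤ 6 * (1 / a) :=
        mul_le_mul hG2 hG0 hG0'.le (by norm_num)
      have e : 0 ≤ Real.Gamma (a + (2 - 2 * a)) ^ 2 * (1 + (2 - 2 * a) ^ 2 / a) := by positivity
      calc _ ≤ 6 * (1 / a) := by linarith
        _ ≤ 100 * (1 / (4 * (n * a))) * ((1 / 2) ^ 2 * n) := by
          have : 100 * (1 / (4 * (n * a))) * ((1 / 2) ^ 2 * n) = 25 / 4 * (1 / a) := by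
            field_simp; norm_num
          rw [this]; gcongr; norm_num
        _ ≤ _ := by gcongr
  · have hS2 : 1 / n ≤ 25 * (n * a / (1 + n * a) ^ 2) := by
      rw [mul_div_assoc', div_le_div_iff₀ hn0 (by positivity)]
      have : 1 / 4 ≤ n * a := by nlinarith
      nlinarith
    refine gen.trans ?_
    rw [mul_comm]
    gcongr
    have := Gamma_excess_le h ha1
    rw [← div_le_iff₀ hg12] at this
    rw [div_eq_mul_one_div _ n]
    calc _ ≤ 400000 * ((2 - 2 * a) ^ 2 * (1 - 2 * a) ^ 2) * (25 * (n * a / (1 + n * a) ^ 2)) :=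
        mul_le_mul this hS2 (by positivity) (by positivity)
      _ = _ := by ring

lemma sq_integral_le_integral_sq {Ω : Type*} [MeasurableSpace Ω] {P : Measure Ω}
    [IsProbabilityMeasure P] {X : Ω → ℝ} (hX : Integrable X P) (hX2 : Integrable (fun x => X x ^ 2) P) :
    (∫ x, X x ∂P) ^ 2 ≤ ∫ x, X x ^ 2 ∂P := by
  set c := ∫ x, X x ∂P with hc
  have h0 : 0 ≤ ∫ x, (X x - c) ^ 2 ∂P := integral_nonneg fun x => sq_nonneg _
  have e : ∫ x, (X x - c) ^ 2 ∂P = ∫ x, (X x ^ 2 - 2 * c * X x + c ^ 2) ∂P :=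
    integral_congr_ae (.of_forall fun x => by ring)
  have i1 : Integrable (fun x => X x ^ 2 - 2 * c * X x) P := hX2.sub (hX.const_mul _)
  rw [e, integral_add i1 (integrable_const _),
    integral_sub hX2 (hX.const_mul _), integral_const_mul, integral_const, ← hc] at h0
  simp only [probReal_univ, one_smul] at h0
  linarith

/-- Reweighting a probability measure by `√h` changes it, in total variation, by at most a
multiple of the relative standard deviation of `h`. -/
lemma abs_sqrt_weight_sub_le {Ω : Type*} [MeasurableSpace Ω] {P : Measure Ω}
    [IsProbabilityMeasure P] {h : Ω → ℝ} {B R : ℝ} (hm : Measurable h) (h0 : ∀ x, 0 ≤ h x)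
    (hB : ∀ᵐ x ∂P, h x ≤ B) (hR : 0 ≤ R) (hpos : 0 < ∫ x, h x ∂P)
    (hvar : ∫ x, h x ^ 2 ∂P - (∫ x, h x ∂P) ^ 2 ≤ R * (∫ x, h x ∂P) ^ 2)
    {A : Set Ω} (hA : MeasurableSet A) :
    |(∫ x in A, √(h x) ∂P) / (∫ x, √(h x) ∂P) - P.real A| ≤ 2 * √R := by
  have ih : Integrable h P := Integrable.of_bound hm.aestronglyMeasurable B
    (hB.mono fun x hx => by rwa [Real.norm_eq_abs, abs_of_nonneg (h0 x)])
  have ih2 : Integrable (fun x => h x ^ 2) P :=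
    Integrable.of_bound (by fun_prop) (B ^ 2)
    (hB.mono fun x hx => by
      rw [Real.norm_eq_abs, abs_of_nonneg (sq_nonneg _)]; exact pow_le_pow_left₀ (h0 x) hx 2)
  have ifn : Integrable (fun x => √(h x)) P := Integrable.of_bound (by fun_prop) (√B)
    (hB.mono fun x hx => by
      rw [Real.norm_eq_abs, abs_of_nonneg (Real.sqrt_nonneg _)]; exact Real.sqrt_le_sqrt hx)
  set M1 := ∫ x, h x ∂P with hM1
  set M2 := ∫ x, h x ^ 2 ∂P with hM2
  set F := ∫ x, √(h x) ∂P with hF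
  have hc0 : 0 < √M1 := Real.sqrt_pos.2 hpos
  have hc2 : √M1 ^ 2 = M1 := Real.sq_sqrt hpos.le
  have hF0 : 0 ≤ F := integral_nonneg fun x => Real.sqrt_nonneg _
  have hFA0 : 0 ≤ ∫ x in A, √(h x) ∂P := integral_nonneg fun x => Real.sqrt_nonneg _
  have hFA : ∫ x in A, √(h x) ∂P ≤ F := setIntegral_le_integral ifn
    (.of_forall fun x => Real.sqrt_nonneg _)
  rcases le_total R 1 with hR1 | hR1
  swap
  · have e1 : (∫ x in A, √(h x) ∂P) / F ≤ 1 := div_le_one_of_le₀ hFA hF0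
    have e2 : 0 ≤ (∫ x in A, √(h x) ∂P) / F := by positivity
    have e3 : P.real A ≤ 1 := measureReal_le_one
    have e4 : 0 ≤ P.real A := measureReal_nonneg
    have e5 : 1 ≤ √R := Real.one_le_sqrt.2 hR1
    rw [abs_le]; constructor <;> linarith
  have hFlow : √M1 / 2 ≤ F := by
    have hpt : ∀ x, 3 / (2 * √M1) * h x - 1 / (2 * √M1 ^ 3) * h x ^ 2 ≤ √(h x) := by
      intro x
      obtain ⟨y, hy0, hy⟩ : ∃ y, 0 ≤ y ∧ √(h x) = y := ⟨_, Real.sqrt_nonneg _, rfl⟩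
      have hy2 : h x = y ^ 2 := by rw [← hy, Real.sq_sqrt (h0 x)]
      rw [hy, hy2, ← sub_nonneg]
      have : 0 ≤ y * (y - √M1) ^ 2 * (y + 2 * √M1) / (2 * √M1 ^ 3) := by positivity
      convert this using 1
      field_simp
      ring
    have := integral_mono ((ih.const_mul _).sub (ih2.const_mul _)) ifn hpt
    simp only [Pi.sub_apply] at this
    rw [integral_sub (ih.const_mul _) (ih2.const_mul _), integral_const_mul, integral_const_mul,
      ← hM1, ← hM2, ← hF] at this
    refine le_trans ?_ this
    have hM2' : M2 ≤ 2 * M1 ^ 2 := by nlinarith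
    have e : 3 / (2 * √M1) * M1 - 1 / (2 * √M1 ^ 3) * (2 * M1 ^ 2) = √M1 / 2 := by
      generalize √M1 = c at *
      rw [← hc2]; field_simp; ring
    rw [← e]
    gcongr
  have hvarf : M1 - F ^ 2 ≤ R * M1 := by
    have hpt : ∀ x, h x - 2 * √M1 * √(h x) + M1 ≤
        1 / M1 * h x ^ 2 - 2 * h x + M1 := by
      intro x
      obtain ⟨y, hy0, hy⟩ : ∃ y, 0 ≤ y ∧ √(h x) = y := ⟨_, Real.sqrt_nonneg _, rfl⟩
      have hy2 : h x = y ^ 2 := by rw [← hy, Real.sq_sqrt (h0 x)]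
      rw [hy, hy2]
      generalize √M1 = c at *
      rw [← hc2, ← sub_nonneg]
      have : 0 ≤ (y - c) ^ 2 * (y * (y + 2 * c)) / c ^ 2 := by positivity
      convert this using 1
      field_simp
      ring
    have i1 : Integrable (fun x => h x - 2 * √M1 * √(h x)) P := ih.sub (ifn.const_mul _)
    have i2 : Integrable (fun x => 1 / M1 * h x ^ 2 - 2 * h x) P :=
      (ih2.const_mul _).sub (ih.const_mul _)
    have := integral_mono (i1.add (integrable_const M1)) (i2.add (integrable_const M1)) hpt
    simp only [Pi.add_apply] at this
    rw [integral_add i1 (integrable_const _), integral_add i2 (integrable_const _),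
      integral_sub ih (ifn.const_mul _), integral_sub (ih2.const_mul _) (ih.const_mul _),
      integral_const_mul, integral_const_mul, integral_const_mul, integral_const,
      ← hM1, ← hM2, ← hF] at this
    simp only [probReal_univ, one_smul] at this
    have e : 1 / M1 * M2 - M1 ≤ R * M1 := by
      have : 1 / M1 * M2 - M1 = (M2 - M1 ^ 2) / M1 := by field_simp
      rw [this, div_le_iff₀ hpos]; linarith
    nlinarith [sq_nonneg (√M1 - F)]
  have hFpos : 0 < F := by linarith
  have h_integral : (∫ x in A, √(h x) ∂P) - P.real A * F = ∫ x, A.indicator (fun x => √(h x) - F) x ∂P := by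
    rw [integral_indicator hA, integral_sub ifn.integrableOn (integrable_const _)]
    simp
  have iX : Integrable (fun x => A.indicator (fun x => √(h x) - F) x) P :=
    (ifn.sub (integrable_const _)).indicator hA
  have iY2 : Integrable (fun x => (√(h x) - F) ^ 2) P := by
    have : Integrable (fun x => h x - 2 * F * √(h x) + F ^ 2) P :=
      (ih.sub (ifn.const_mul _)).add (integrable_const _)
    refine this.congr (.of_forall fun x => ?_)
    simp only
    nlinarith [Real.sq_sqrt (h0 x)]
  have iX2 : Integrable (fun x => (A.indicator (fun x => √(h x) - F) x) ^ 2) P := by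
    refine (iY2.indicator hA).congr (.of_forall fun x => ?_)
    by_cases hx : x ∈ A <;> simp [hx]
  have hX := sq_integral_le_integral_sq iX iX2
  have hXY : ∫ x, (A.indicator (fun x => √(h x) - F) x) ^ 2 ∂P ≤ ∫ x, (√(h x) - F) ^ 2 ∂P := by
    refine integral_mono iX2 iY2 fun x => ?_
    by_cases hx : x ∈ A <;> simp [hx, sq_nonneg]
  have hY : ∫ x, (√(h x) - F) ^ 2 ∂P = M1 - F ^ 2 := by
    have : ∫ x, (√(h x) - F) ^ 2 ∂P = ∫ x, (h x - 2 * F * √(h x) + F ^ 2) ∂P := by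
      refine integral_congr_ae (.of_forall fun x => ?_)
      simp only
      nlinarith [Real.sq_sqrt (h0 x)]
    have i1 : Integrable (fun x => h x - 2 * F * √(h x)) P := ih.sub (ifn.const_mul _)
    rw [this, integral_add i1 (integrable_const _),
      integral_sub ih (ifn.const_mul _), integral_const_mul, integral_const, ← hM1, ← hF]
    simp only [probReal_univ, one_smul]
    ring
  rw [← h_integral] at hX
  have e : (∫ x in A, √(h x) ∂P) / F - P.real A = ((∫ x in A, √(h x) ∂P) - P.real A * F) / F := by
    field_simp
  rw [e, abs_div, abs_of_pos hFpos, div_le_iff₀ hFpos]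
  have h1 : |(∫ x in A, √(h x) ∂P) - P.real A * F| ≤ √R * √M1 := by
    rw [← Real.sqrt_mul hR]
    refine Real.abs_le_sqrt ?_
    linarith
  have : √R * √M1 ≤ 2 * √R * F := by nlinarith [Real.sqrt_nonneg R]
  linarith

open scoped Pointwise in
/-- The volume of the cone over a piece of the hyperplane `⟪g, x⟫ = 1`. -/
lemma volume_coneSet_of_inner_eq_one {n : ℕ} (hn : 1 ≤ n) {g : EuclideanSpace ℝ (Fin n)} (hg : g ≠ 0)
    {A : Set (EuclideanSpace ℝ (Fin n))} (hA : MeasurableSet A) (hAg : ∀ x ∈ A, inner ℝ g x = 1) :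
    volume (coneSet A) = ENNReal.ofReal (1 / (n * ‖g‖)) * Measure.euclideanHausdorffMeasure (n - 1) A := by
  have : Nonempty (Fin n) := ⟨⟨0, hn⟩⟩
  have hg0 : 0 < ‖g‖ := norm_pos_iff.2 hg
  set K : Set (EuclideanSpace ℝ (Fin n)) :=
    {y | inner ℝ g y ∈ Ioc (0 : ℝ) 1 ∧ (inner ℝ g y)⁻¹ • y ∈ A} with hK
  have hKm : MeasurableSet K := by
    have h1 : Measurable fun y : EuclideanSpace ℝ (Fin n) => (inner ℝ g y : ℝ) := by fun_prop
    have h2 : Measurable fun y : EuclideanSpace ℝ (Fin n) => (inner ℝ g y : ℝ)⁻¹ • y := by fun_prop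
    exact (h1 measurableSet_Ioc).inter (h2 hA)
  have hKc : volume (coneSet A) = volume K := by
    refine measure_congr ?_
    have h0 : ∀ᵐ y : EuclideanSpace ℝ (Fin n), y ≠ 0 := by
      simp [ae_iff]
    filter_upwards [h0] with y hy
    refine propext ⟨?_, ?_⟩
    · rintro ⟨r, hr, a, ha, rfl⟩
      have hr0 : r ≠ 0 := by rintro rfl; simp at hy
      have : inner ℝ g (r • a) = r := by rw [inner_smul_right, hAg a ha, mul_one]
      refine ⟨?_, ?_⟩
      · simp only [this]; exact ⟨lt_of_le_of_ne hr.1 hr0.symm, hr.2⟩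
      · simp only [this]; rwa [smul_smul, inv_mul_cancel₀ hr0, one_smul]
    · rintro ⟨h1, h2⟩
      refine ⟨_, ⟨h1.1.le, h1.2⟩, _, h2, ?_⟩
      simp only
      rw [smul_smul, mul_inv_cancel₀ h1.1.ne', one_smul]
  set v : EuclideanSpace ℝ (Fin n) := (‖g‖ ^ 2)⁻¹ • g with hv
  have hgv : inner ℝ g v = (1 : ℝ) := by
    rw [hv, inner_smul_right, real_inner_self_eq_norm_sq, inv_mul_cancel₀ (by positivity)]
  have hv0 : v ≠ 0 := by rintro h; rw [h] at hgv; simp at hgv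
  have hvn : ‖v‖ = 1 / ‖g‖ := by
    rw [hv, norm_smul, norm_inv, norm_pow, norm_norm]; field_simp
  have hmem : ∀ (x : ℝ) (y : EuclideanSpace ℝ (Fin n)),
      y ∈ AffineSubspace.mk' (x • v +ᵥ (0 : EuclideanSpace ℝ (Fin n))) (Submodule.span ℝ {v})ᗮ ↔ inner ℝ g y = x := by
    intro x y
    rw [AffineSubspace.mem_mk', Submodule.mem_orthogonal_singleton_iff_inner_right]
    simp only [vadd_eq_add, add_zero, vsub_eq_sub]
    rw [hv, real_inner_smul_left, ← hv, inner_sub_right, inner_smul_right, hgv, mul_one]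
    have : (‖g‖ ^ 2)⁻¹ ≠ 0 := by positivity
    rw [mul_eq_zero, or_iff_right this, sub_eq_zero]
  have hslice : ∀ x : ℝ, (Measure.euclideanHausdorffMeasure (n - 1) : Measure (EuclideanSpace ℝ (Fin n)))
      (K ∩ AffineSubspace.mk' (x • v +ᵥ (0 : EuclideanSpace ℝ (Fin n))) (Submodule.span ℝ {v})ᗮ) =
      (Ioc (0 : ℝ) 1).indicator (fun x => ENNReal.ofReal (x ^ (n - 1)) * Measure.euclideanHausdorffMeasure (n - 1) A) x := by
    intro x
    by_cases hx : x ∈ Ioc (0 : ℝ) 1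
    · rw [indicator_of_mem hx]
      have : K ∩ AffineSubspace.mk' (x • v +ᵥ (0 : EuclideanSpace ℝ (Fin n))) (Submodule.span ℝ {v})ᗮ = x • A := by
        ext y
        simp only [mem_inter_iff, SetLike.mem_coe, hmem, mem_smul_set_iff_inv_smul_mem₀ hx.1.ne']
        constructor
        · rintro ⟨h, rfl⟩; exact h.2
        · intro h
          have h1 := hAg _ h
          rw [inner_smul_right] at h1
          have h2 : inner ℝ g y = x := by
            have := hx.1.ne'
            field_simp at h1; linarith
          refine ⟨⟨?_, ?_⟩, h2⟩
          · simpa only [h2] using hx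
          · simpa only [h2] using h
      rw [this, Measure.euclideanHausdorffMeasure_smul₀ _ hx.1.ne']
      rw [ENNReal.smul_def, smul_eq_mul]
      congr 1
      rw [ENNReal.coe_pow, ENNReal.ofReal_pow hx.1.le]
      congr 1
      rw [← enorm_eq_nnnorm, Real.enorm_eq_ofReal hx.1.le]
    · rw [indicator_of_notMem hx]
      have : K ∩ AffineSubspace.mk' (x • v +ᵥ (0 : EuclideanSpace ℝ (Fin n))) (Submodule.span ℝ {v})ᗮ = ∅ := by
        ext y
        simp only [mem_inter_iff, SetLike.mem_coe, hmem, mem_empty_iff_false, iff_false]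
        rintro ⟨h, rfl⟩
        exact hx h.1
      rw [this, measure_empty]
  have key := EuclideanGeometry.euclideanHausdorffMeasure_eq_lintegral (0 : EuclideanSpace ℝ (Fin n)) hv0 hKm
  rw [InnerProductSpace.euclideanHausdorffMeasure_eq_volume] at key
  rw [hKc, key, finrank_euclideanSpace_fin]
  simp_rw [hslice]
  rw [lintegral_indicator measurableSet_Ioc, lintegral_mul_const _ (by fun_prop),
    ← ofReal_integral_eq_lintegral_ofReal, ← intervalIntegral.integral_of_le zero_le_one, integral_pow,
    ← mul_assoc]
  · congr 1
    rw [← ofReal_norm, ← ENNReal.ofReal_mul (norm_nonneg _), hvn]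
    congr 1
    have : ((n - 1 : ℕ) : ℝ) + 1 = n := by rw [Nat.cast_sub hn]; simp
    rw [this, Nat.sub_add_cancel hn]
    simp
    have : n ≠ 0 := by omega
    simp [this]
  · exact (continuous_pow _).integrableOn_Icc.mono_set Ioc_subset_Icc_self
  · filter_upwards [ae_restrict_mem measurableSet_Ioc] with x hx
    exact pow_nonneg hx.1.le _

open scoped Pointwise in
/-- Near a point `x₀` where `S` is tangent to the hyperplane `⟪g, x⟫ = 1`, the Hausdorff measure
of a piece of `S` is almost `n‖g‖` times the volume of the cone over it. -/
lemma exists_nhds_hausdorff_cone_comparison {n : ℕ} (hn : 1 ≤ n)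
    {S : Set (EuclideanSpace ℝ (Fin n))}
    {g x₀ : EuclideanSpace ℝ (Fin n)} (hgx : inner ℝ g x₀ = (1 : ℝ))
    (htan : ∀ ε > 0, ∃ U ∈ nhds x₀, ∀ x ∈ S ∩ U, ∀ y ∈ S ∩ U, |inner ℝ g (x - y)| ≤ ε * ‖x - y‖)
    {K : ℝ} (hK : 1 < K) :
    ∃ U ∈ nhds x₀, ∀ A, MeasurableSet A → A ⊆ S ∩ U →
      Measure.euclideanHausdorffMeasure (n - 1) A ≤
        ENNReal.ofReal (K ^ (2 * n - 1) * (n * ‖g‖)) * volume (coneSet A) ∧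
      ENNReal.ofReal (n * ‖g‖) * volume (coneSet A) ≤
        ENNReal.ofReal (K ^ (2 * n - 1)) * Measure.euclideanHausdorffMeasure (n - 1) A := by
  have hK0 : 0 < K := by linarith
  have hg : g ≠ 0 := by rintro rfl; simp at hgx
  have hg0 : 0 < ‖g‖ := norm_pos_iff.2 hg
  obtain ⟨η, hη0, hη1, hη2⟩ : ∃ η : ℝ, 0 < η ∧ 1 + 2 * η ≤ K ∧ K⁻¹ ≤ 1 - 2 * η := by
    have : K⁻¹ < 1 := inv_lt_one_of_one_lt₀ hK
    refine ⟨min ((K - 1) / 2) ((1 - K⁻¹) / 2), ?_, ?_, ?_⟩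
    · apply lt_min <;> linarith
    · linarith [min_le_left ((K - 1) / 2) ((1 - K⁻¹) / 2)]
    · linarith [min_le_right ((K - 1) / 2) ((1 - K⁻¹) / 2)]
  obtain ⟨U₁, hU₁, hU₁'⟩ := htan (η / (‖x₀‖ + 1)) (by positivity)
  have c0 : ContinuousAt (fun x : EuclideanSpace ℝ (Fin n) => (inner ℝ g x : ℝ)) x₀ := by fun_prop
  have c1 : ContinuousAt (fun x : EuclideanSpace ℝ (Fin n) => (inner ℝ g x : ℝ)⁻¹) x₀ :=
    c0.inv₀ (by rw [hgx]; norm_num)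
  have e1 : ∀ᶠ x in nhds x₀, |(inner ℝ g x : ℝ)⁻¹ - 1| < η := by
    have := c1.eventually (Metric.ball_mem_nhds _ hη0)
    filter_upwards [this] with x hx
    simpa [hgx, Real.dist_eq] using hx
  have e2 : ∀ᶠ x in nhds x₀, (0 : ℝ) < inner ℝ g x := 
    c0.eventually (lt_mem_nhds (by simp [hgx]))
  have e3 : ∀ᶠ z in nhds (x₀, x₀), |(inner ℝ g z.1 : ℝ)⁻¹| * |(inner ℝ g z.2 : ℝ)⁻¹| * ‖z.2‖ < ‖x₀‖ + 1 := by
    have : ContinuousAt (fun z : EuclideanSpace ℝ (Fin n) × EuclideanSpace ℝ (Fin n) =>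
        |(inner ℝ g z.1 : ℝ)⁻¹| * |(inner ℝ g z.2 : ℝ)⁻¹| * ‖z.2‖) (x₀, x₀) := by
      have d1 : ContinuousAt (fun z : EuclideanSpace ℝ (Fin n) × EuclideanSpace ℝ (Fin n) =>
        (inner ℝ g z.1 : ℝ)⁻¹) (x₀, x₀) :=
        ContinuousAt.comp (f := Prod.fst) (x := (x₀, x₀)) c1 continuousAt_fst
      have d2 : ContinuousAt (fun z : EuclideanSpace ℝ (Fin n) × EuclideanSpace ℝ (Fin n) =>
        (inner ℝ g z.2 : ℝ)⁻¹) (x₀, x₀) :=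
        ContinuousAt.comp (f := Prod.snd) (x := (x₀, x₀)) c1 continuousAt_snd
      exact (d1.abs.mul d2.abs).mul continuousAt_snd.norm
    refine this.eventually (gt_mem_nhds ?_)
    simp [hgx]
  rw [nhds_prod_eq] at e3
  obtain ⟨U₂, hU₂, hU₂'⟩ := Filter.eventually_prod_self_iff'.1 e3
  refine ⟨U₁ ∩ (U₂ ∩ ({x | |(inner ℝ g x : ℝ)⁻¹ - 1| < η} ∩ {x | (0 : ℝ) < inner ℝ g x})),
    Filter.inter_mem hU₁ (Filter.inter_mem hU₂ (Filter.inter_mem e1 e2)), ?_⟩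
  intro A hA hAU
  set ψ : EuclideanSpace ℝ (Fin n) → EuclideanSpace ℝ (Fin n) := fun x => (inner ℝ g x : ℝ)⁻¹ • x with hψ
  have hpos : ∀ x ∈ A, (0 : ℝ) < inner ℝ g x := fun x hx => (hAU hx).2.2.2.2
  have hnear : ∀ x ∈ A, |(inner ℝ g x : ℝ)⁻¹ - 1| < η := fun x hx => (hAU hx).2.2.2.1
  have hdiff : ∀ x ∈ A, ∀ y ∈ A, ‖(ψ x - ψ y) - (x - y)‖ ≤ 2 * η * ‖x - y‖ := by
    intro x hx y hy
    have hx0 := (hpos x hx).ne'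
    have hy0 := (hpos y hy).ne'
    have e : (ψ x - ψ y) - (x - y) = ((inner ℝ g x : ℝ)⁻¹ - 1) • (x - y) +
        (-(inner ℝ g (x - y)) * ((inner ℝ g x : ℝ)⁻¹ * (inner ℝ g y : ℝ)⁻¹)) • y := by
      have : (inner ℝ g x : ℝ)⁻¹ - (inner ℝ g y : ℝ)⁻¹ =
          -(inner ℝ g (x - y)) * ((inner ℝ g x : ℝ)⁻¹ * (inner ℝ g y : ℝ)⁻¹) := by
        rw [inner_sub_right]; field_simp; ring
      rw [← this]
      simp only [hψ]
      module
    rw [e]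
    refine (norm_add_le _ _).trans ?_
    rw [norm_smul, norm_smul, Real.norm_eq_abs, Real.norm_eq_abs, abs_mul, abs_neg, abs_mul]
    have h1 := hU₁' x ⟨(hAU hx).1, (hAU hx).2.1⟩ y ⟨(hAU hy).1, (hAU hy).2.1⟩
    have h2 := hU₂' x (hAU hx).2.2.1 y (hAU hy).2.2.1
    have h3 := hnear x hx
    simp only at h2
    have t1 : |(inner ℝ g x : ℝ)⁻¹ - 1| * ‖x - y‖ ≤ η * ‖x - y‖ := by gcongr
    have t2 : |inner ℝ g (x - y)| * (|(inner ℝ g x : ℝ)⁻¹| * |(inner ℝ g y : ℝ)⁻¹|) * ‖y‖ ≤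
        η * ‖x - y‖ := by
      rw [mul_assoc]
      calc _ ≤ (η / (‖x₀‖ + 1) * ‖x - y‖) * (‖x₀‖ + 1) := by gcongr
        _ = _ := by field_simp
    linarith
  have hup : ∀ x ∈ A, ∀ y ∈ A, ‖ψ x - ψ y‖ ≤ K * ‖x - y‖ := by
    intro x hx y hy
    have h := hdiff x hx y hy
    have : ‖ψ x - ψ y‖ ≤ ‖(ψ x - ψ y) - (x - y)‖ + ‖x - y‖ := by
      simpa using norm_add_le ((ψ x - ψ y) - (x - y)) (x - y)
    nlinarith [norm_nonneg (x - y)]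
  have hlow : ∀ x ∈ A, ∀ y ∈ A, ‖x - y‖ ≤ K * ‖ψ x - ψ y‖ := by
    intro x hx y hy
    have h := hdiff x hx y hy
    have h' : ‖x - y‖ ≤ ‖(ψ x - ψ y) - (x - y)‖ + ‖ψ x - ψ y‖ := by
      have := norm_sub_le (ψ x - ψ y) ((ψ x - ψ y) - (x - y))
      rw [sub_sub_cancel] at this; linarith
    have : K⁻¹ * ‖x - y‖ ≤ ‖ψ x - ψ y‖ := by nlinarith [norm_nonneg (x - y)]
    rwa [inv_mul_le_iff₀ hK0] at this
  have hinj : InjOn ψ A := by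
    intro x hx y hy hxy
    have := hlow x hx y hy
    rw [hxy, sub_self, norm_zero, mul_zero] at this
    exact sub_eq_zero.1 (norm_le_zero_iff.1 this)
  set k : NNReal := ⟨K, hK0.le⟩ with hk
  have hLip : LipschitzOnWith k ψ A := by
    refine LipschitzOnWith.of_dist_le_mul fun x hx y hy => ?_
    rw [dist_eq_norm, dist_eq_norm]; exact hup x hx y hy
  set B := ψ '' A with hB
  have hBm : MeasurableSet B := hA.image_of_continuousOn_injOn hLip.continuousOn hinj
  have hinv : ∀ x ∈ A, Function.invFunOn ψ A (ψ x) = x := fun x hx => hinj.leftInvOn_invFunOn hx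
  have hLip' : LipschitzOnWith k (Function.invFunOn ψ A) B := by
    refine LipschitzOnWith.of_dist_le_mul ?_
    rintro _ ⟨x, hx, rfl⟩ _ ⟨y, hy, rfl⟩
    rw [dist_eq_norm, dist_eq_norm, hinv x hx, hinv y hy]; exact hlow x hx y hy
  have hBA : Function.invFunOn ψ A '' B = A := by
    rw [hB, image_image]
    ext x; constructor
    · rintro ⟨y, hy, rfl⟩; simp only; rwa [hinv y hy]
    · intro hx; exact ⟨x, hx, hinv x hx⟩
  have hhaus : ∀ (f : EuclideanSpace ℝ (Fin n) → EuclideanSpace ℝ (Fin n)) (s : Set _),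
      LipschitzOnWith k f s → Measure.euclideanHausdorffMeasure (n - 1) (f '' s) ≤
        ENNReal.ofReal (K ^ (n - 1)) * Measure.euclideanHausdorffMeasure (n - 1) s := by
    intro f s hf
    have := hf.hausdorffMeasure_image_le (d := ((n - 1 : ℕ) : ℝ)) (by positivity)
    rw [Measure.euclideanHausdorffMeasure_def, Measure.smul_apply, Measure.smul_apply,
      ENNReal.smul_def, ENNReal.smul_def, smul_eq_mul, smul_eq_mul, mul_left_comm]
    gcongr
    refine this.trans_eq ?_
    rw [ENNReal.rpow_natCast, ENNReal.ofReal_pow hK0.le]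
    congr 2
    rw [ENNReal.ofReal, Real.toNNReal_of_nonneg hK0.le]
    rfl
  have hAB := hhaus _ _ hLip
  have hBA' := hhaus _ _ hLip'
  rw [hBA] at hBA'
  rw [← hB] at hAB
  have hBg : ∀ x ∈ B, inner ℝ g x = (1 : ℝ) := by
    rintro _ ⟨x, hx, rfl⟩
    simp only [hψ]
    rw [inner_smul_right, inv_mul_cancel₀ (hpos x hx).ne']
  have hBv := volume_coneSet_of_inner_eq_one hn hg hBm hBg
  have hn0 : (0 : ℝ) < n := by exact_mod_cast hn
  have hBv' : ENNReal.ofReal (n * ‖g‖) * volume (coneSet B) = Measure.euclideanHausdorffMeasure (n - 1) B := by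
    rw [hBv, ← mul_assoc, ← ENNReal.ofReal_mul (by positivity)]
    have : (n * ‖g‖) * (1 / (n * ‖g‖)) = 1 := by field_simp
    rw [this, ENNReal.ofReal_one, one_mul]
  have hvol : ∀ s : Set (EuclideanSpace ℝ (Fin n)), volume (K • s) = ENNReal.ofReal (K ^ n) * volume s := by
    intro s
    rw [Measure.addHaar_smul, finrank_euclideanSpace_fin, abs_of_pos (by positivity)]
  have hcA : coneSet A ⊆ K • coneSet B := by
    rintro _ ⟨r, hr, x, hx, rfl⟩
    have h1 := hpos x hx
    have h2 : inner ℝ g x ≤ K := by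
      have := (abs_lt.1 (hnear x hx)).1
      have h3 : K⁻¹ ≤ (inner ℝ g x)⁻¹ := by linarith
      exact (inv_le_inv₀ hK0 h1).1 h3
    refine ⟨(r * (inner ℝ g x) / K) • ψ x, ⟨r * (inner ℝ g x) / K, ⟨?_, ?_⟩, ψ x, ⟨x, hx, rfl⟩, rfl⟩, ?_⟩
    · have := hr.1; positivity
    · rw [div_le_one hK0]; nlinarith [hr.1, hr.2]
    · simp only [hψ, smul_smul]
      congr 1
      field_simp
  have hcB : coneSet B ⊆ K • coneSet A := by
    rintro _ ⟨r, hr, _, ⟨x, hx, rfl⟩, rfl⟩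
    have h1 := hpos x hx
    have h2 : (inner ℝ g x)⁻¹ ≤ K := by
      have := (abs_lt.1 (hnear x hx)).2
      linarith
    have h3 : 0 < (inner ℝ g x)⁻¹ := inv_pos.2 h1
    refine ⟨(r * (inner ℝ g x)⁻¹ / K) • x, ⟨r * (inner ℝ g x)⁻¹ / K, ⟨?_, ?_⟩, x, hx, rfl⟩, ?_⟩
    · have := hr.1; positivity
    · rw [div_le_one hK0]; nlinarith [hr.1, hr.2]
    · simp only [hψ, smul_smul]
      congr 1
      field_simp
  have hcA' := (measure_mono hcA).trans_eq (hvol _)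
  have hcB' := (measure_mono hcB).trans_eq (hvol _)
  have hKK : K ^ (2 * n - 1) = K ^ (n - 1) * K ^ n := by rw [← pow_add]; congr 1; omega
  rw [hKK]
  constructor
  · calc _ ≤ ENNReal.ofReal (K ^ (n - 1)) * (ENNReal.ofReal (n * ‖g‖) * volume (coneSet B)) := by
          rw [hBv']; exact hBA'
      _ ≤ ENNReal.ofReal (K ^ (n - 1)) * (ENNReal.ofReal (n * ‖g‖) *
          (ENNReal.ofReal (K ^ n) * volume (coneSet A))) := by gcongr
      _ = _ := by
          rw [ENNReal.ofReal_mul (p := K ^ (n - 1) * K ^ n) (by positivity),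
            ENNReal.ofReal_mul (p := K ^ (n - 1)) (by positivity)]
          ring
  · calc _ ≤ ENNReal.ofReal (n * ‖g‖) * (ENNReal.ofReal (K ^ n) * volume (coneSet B)) := by gcongr
      _ = ENNReal.ofReal (K ^ n) * (ENNReal.ofReal (n * ‖g‖) * volume (coneSet B)) := by ring
      _ ≤ ENNReal.ofReal (K ^ n) * (ENNReal.ofReal (K ^ (n - 1)) *
            Measure.euclideanHausdorffMeasure (n - 1) A) := by rw [hBv']; gcongr
      _ = _ := by
          rw [ENNReal.ofReal_mul (p := K ^ (n - 1)) (by positivity)]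
          ring

/-- Two measures that are comparable up to factors arbitrarily close to `1` on the pieces of a
countable cover of `S` agree on `S`. -/
lemma measure_eq_of_cover_comparison {E : Type*} [MeasurableSpace E] {α β : Measure E} {S : Set E}
    (h : ∀ L : ℝ, 1 < L → ∃ V : ℕ → Set E, (∀ i, MeasurableSet (V i)) ∧ S ⊆ ⋃ i, V i ∧
      ∀ i A, MeasurableSet A → A ⊆ S ∩ V i →
        α A ≤ ENNReal.ofReal L * β A ∧ β A ≤ ENNReal.ofReal L * α A)
    {A : Set E} (hA : MeasurableSet A) (hAS : A ⊆ S) : α A = β A := by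
  have key : ∀ L : ℝ, 1 < L → α A ≤ ENNReal.ofReal L * β A ∧ β A ≤ ENNReal.ofReal L * α A := by
    intro L hL
    obtain ⟨V, hV, hSV, hcomp⟩ := h L hL
    have hU : A = ⋃ i, A ∩ disjointed V i := by
      rw [← inter_iUnion, iUnion_disjointed, inter_eq_left.2 (hAS.trans hSV)]
    have hm : ∀ i, MeasurableSet (A ∩ disjointed V i) := fun i => hA.inter (.disjointed hV i)
    have hd : Pairwise (Function.onFun Disjoint fun i => A ∩ disjointed V i) := fun i j hij =>
      (disjoint_disjointed V hij).mono inter_subset_right inter_subset_right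
    have hs : ∀ i, A ∩ disjointed V i ⊆ S ∩ V i := fun i =>
      inter_subset_inter hAS (disjointed_subset V i)
    have e : ∀ μ : Measure E, μ A = ∑' i, μ (A ∩ disjointed V i) := fun μ => by
      conv_lhs => rw [hU]
      exact measure_iUnion hd hm
    rw [e α, e β, ← ENNReal.tsum_mul_left, ← ENNReal.tsum_mul_left]
    exact ⟨ENNReal.tsum_le_tsum fun i => (hcomp i _ (hm i) (hs i)).1,
      ENNReal.tsum_le_tsum fun i => (hcomp i _ (hm i) (hs i)).2⟩
  have lim : ∀ a b : ℝ≥0∞, (∀ L : ℝ, 1 < L → a ≤ ENNReal.ofReal L * b) → a ≤ b := by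
    intro a b hab
    have h1 : Filter.Tendsto (fun L : ℝ => ENNReal.ofReal L * b) (nhdsWithin 1 (Ioi 1))
        (nhds (ENNReal.ofReal 1 * b)) := by
      refine ENNReal.Tendsto.mul_const ?_ (Or.inl (by simp))
      exact (ENNReal.continuous_ofReal.tendsto 1).mono_left nhdsWithin_le_nhds
    rw [ENNReal.ofReal_one, one_mul] at h1
    refine ge_of_tendsto h1 ?_
    filter_upwards [self_mem_nhdsWithin] with L hL using hab L hL
  exact le_antisymm (lim _ _ fun L hL => (key L hL).1) (lim _ _ fun L hL => (key L hL).2)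

lemma measure_eq_of_local_comparison {E : Type*} [MeasurableSpace E] [TopologicalSpace E]
    [SecondCountableTopology E] [OpensMeasurableSpace E] {α β : Measure E} {S : Set E}
    (h : ∀ L : ℝ, 1 < L → ∀ x ∈ S, ∃ U ∈ nhds x, ∀ A, MeasurableSet A → A ⊆ S ∩ U →
        α A ≤ ENNReal.ofReal L * β A ∧ β A ≤ ENNReal.ofReal L * α A)
    {A : Set E} (hA : MeasurableSet A) (hAS : A ⊆ S) : α A = β A := by
  rcases S.eq_empty_or_nonempty with rfl | hS
  · rw [subset_empty_iff.1 hAS]; simp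
  refine measure_eq_of_cover_comparison (S := S) (fun L hL => ?_) hA hAS
  choose! U hU hcomp using h L hL
  obtain ⟨t, htS, htc, hcov⟩ := TopologicalSpace.countable_cover_nhdsWithin
    (f := fun x => interior (U x)) (s := S)
    fun x hx => mem_nhdsWithin_of_mem_nhds (interior_mem_nhds.2 (hU x hx))
  have htn : t.Nonempty := by
    rw [nonempty_iff_ne_empty]; rintro rfl
    simp at hcov; exact hS.ne_empty hcov
  obtain ⟨e, rfl⟩ := htc.exists_eq_range htn
  refine ⟨fun i => interior (U (e i)), fun i => isOpen_interior.measurableSet, ?_, ?_⟩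
  · simpa using hcov
  · intro i A hA hAi
    exact hcomp _ (htS ⟨i, rfl⟩) A hA (hAi.trans (inter_subset_inter_right _ interior_subset))

/-- The `p`-th power of the `p`-norm. -/
noncomputable def powerSum {n : ℕ} (p : ℝ) (x : EuclideanSpace ℝ (Fin n)) : ℝ := ∑ i, |x i| ^ p

/-- The radial projection onto the sphere of the `p`-norm. -/
noncomputable def radialProj {n : ℕ} (p : ℝ) (x : EuclideanSpace ℝ (Fin n)) :
    EuclideanSpace ℝ (Fin n) := (powerSum p x) ^ (-(1 / p)) • x

/-- The unnormalized cone measure on the sphere of the `p`-norm. -/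
noncomputable def coneMeasure (n : ℕ) (p : ℝ) : Measure (EuclideanSpace ℝ (Fin n)) :=
  (volume.restrict {x | powerSum p x ≤ 1}).map (radialProj p)

section PowerSum

variable {n : ℕ} {p : ℝ}

lemma powerSum_nonneg (x : EuclideanSpace ℝ (Fin n)) : 0 ≤ powerSum p x :=
  Finset.sum_nonneg fun _ _ => Real.rpow_nonneg (abs_nonneg _) _

lemma continuous_powerSum (hp : 0 ≤ p) :
    Continuous (powerSum p : EuclideanSpace ℝ (Fin n) → ℝ) := by
  unfold powerSum
  refine continuous_finsetSum _ fun i _ => Continuous.rpow_const (by fun_prop) fun x => Or.inr hp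

lemma measurable_radialProj (hp : 0 ≤ p) :
    Measurable (radialProj p : EuclideanSpace ℝ (Fin n) → EuclideanSpace ℝ (Fin n)) := by
  unfold radialProj
  have := (continuous_powerSum (n := n) hp).measurable
  fun_prop

lemma powerSum_smul {c : ℝ} (hc : 0 ≤ c) (x : EuclideanSpace ℝ (Fin n)) :
    powerSum p (c • x) = c ^ p * powerSum p x := by
  unfold powerSum
  rw [Finset.mul_sum]
  refine Finset.sum_congr rfl fun i _ => ?_
  rw [PiLp.smul_apply, smul_eq_mul, abs_mul, abs_of_nonneg hc, Real.mul_rpow hc (abs_nonneg _)]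

lemma powerSum_pos (hp : 0 < p) {x : EuclideanSpace ℝ (Fin n)} (hx : x ≠ 0) : 0 < powerSum p x := by
  refine lt_of_le_of_ne (powerSum_nonneg x) fun h => hx ?_
  ext i
  have := (Finset.sum_eq_zero_iff_of_nonneg
    (fun i _ => Real.rpow_nonneg (abs_nonneg (x i)) p)).1 h.symm i (Finset.mem_univ i)
  rw [Real.rpow_eq_zero (abs_nonneg _) hp.ne'] at this
  simpa using this

lemma powerSum_zero (hp : 0 < p) : powerSum p (0 : EuclideanSpace ℝ (Fin n)) = 0 := by
  simp [powerSum, Real.zero_rpow hp.ne']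

lemma mem_pSphere_iff (hp : 0 < p) {x : EuclideanSpace ℝ (Fin n)} :
    x ∈ pSphere n p ↔ powerSum p x = 1 := by
  change (powerSum p x) ^ (1 / p) = 1 ↔ _
  have := Real.rpow_left_inj (powerSum_nonneg (p := p) x) zero_le_one (z := 1 / p) (by positivity)
  rwa [Real.one_rpow] at this

lemma pBall_eq (hp : 0 < p) : pBall n p = {x | powerSum p x ≤ 1} := by
  ext x
  change (powerSum p x) ^ (1 / p) ≤ 1 ↔ powerSum p x ≤ 1
  have := Real.rpow_le_rpow_iff (powerSum_nonneg (p := p) x) zero_le_one (z := 1 / p) (by positivity)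
  rwa [Real.one_rpow] at this

lemma measurableSet_pSphere (hp : 0 < p) : MeasurableSet (pSphere n p) := by
  have : pSphere n p = powerSum p ⁻¹' {1} := by ext x; exact mem_pSphere_iff hp
  rw [this]
  exact (continuous_powerSum hp.le).measurable (measurableSet_singleton 1)

lemma powerSum_radialProj (hp : 0 < p) {x : EuclideanSpace ℝ (Fin n)} (hx : x ≠ 0) :
    powerSum p (radialProj p x) = 1 := by
  have h := powerSum_pos hp hx
  rw [radialProj, powerSum_smul (by positivity), ← Real.rpow_mul h.le]
  have : -(1 / p) * p = -1 := by field_simp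
  rw [this, Real.rpow_neg_one, inv_mul_cancel₀ h.ne']

lemma rpow_smul_radialProj (hp : 0 < p) {x : EuclideanSpace ℝ (Fin n)} (hx : x ≠ 0) :
    (powerSum p x) ^ (1 / p) • radialProj p x = x := by
  have h := powerSum_pos hp hx
  rw [radialProj, smul_smul, ← Real.rpow_add h]
  simp

lemma radialProj_smul (hp : 0 < p) {c : ℝ} (hc : 0 < c) (x : EuclideanSpace ℝ (Fin n)) :
    radialProj p (c • x) = radialProj p x := by
  rw [radialProj, radialProj, powerSum_smul hc.le, smul_smul,
    Real.mul_rpow (by positivity) (powerSum_nonneg x), ← Real.rpow_mul hc.le]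
  have : p * -(1 / p) = -1 := by field_simp
  rw [this, Real.rpow_neg_one]
  congr 1
  field_simp

lemma radialProj_of_mem {x : EuclideanSpace ℝ (Fin n)} (hx : powerSum p x = 1) :
    radialProj p x = x := by
  rw [radialProj, hx, Real.one_rpow, one_smul]

lemma ae_ne_zero (hn : 1 ≤ n) : ∀ᵐ x : EuclideanSpace ℝ (Fin n), x ≠ 0 := by
  have : Nonempty (Fin n) := ⟨⟨0, hn⟩⟩
  simp [ae_iff]

lemma coneMeasure_apply (hn : 1 ≤ n) (hp : 0 < p) {A : Set (EuclideanSpace ℝ (Fin n))}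
    (hA : MeasurableSet A) (hAS : A ⊆ pSphere n p) :
    coneMeasure n p A = volume (coneSet A) := by
  rw [coneMeasure, Measure.map_apply (measurable_radialProj hp.le) hA,
    Measure.restrict_apply (measurable_radialProj hp.le hA)]
  refine measure_congr ?_
  filter_upwards [ae_ne_zero hn] with x hx
  refine propext ⟨?_, ?_⟩
  · rintro ⟨h1, h2⟩
    refine ⟨(powerSum p x) ^ (1 / p), ⟨by have := powerSum_nonneg (p := p) x; positivity,
      Real.rpow_le_one (powerSum_nonneg x) h2 (by positivity)⟩, _, h1, rpow_smul_radialProj hp hx⟩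
  · rintro ⟨r, hr, a, ha, rfl⟩
    have hr0 : 0 < r := lt_of_le_of_ne hr.1 (by rintro rfl; simp at hx)
    have ha1 := (mem_pSphere_iff hp).1 (hAS ha)
    refine ⟨?_, ?_⟩
    · change radialProj p (r • a) ∈ A
      rwa [radialProj_smul hp hr0, radialProj_of_mem ha1]
    · change powerSum p (r • a) ≤ 1
      rw [powerSum_smul hr.1, ha1, mul_one]
      exact Real.rpow_le_one hr.1 hr.2 hp.le

lemma ae_coneMeasure (hn : 1 ≤ n) (hp : 0 < p) : ∀ᵐ x ∂(coneMeasure n p), powerSum p x = 1 := by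
  have hm : MeasurableSet {x : EuclideanSpace ℝ (Fin n) | powerSum p x = 1} :=
    (continuous_powerSum hp.le).measurable (measurableSet_singleton 1)
  rw [coneMeasure, ae_map_iff (measurable_radialProj hp.le).aemeasurable hm]
  refine ae_restrict_of_ae ?_
  filter_upwards [ae_ne_zero hn] with x hx using powerSum_radialProj hp hx

end PowerSum

section Density

variable {n : ℕ} {p : ℝ}

lemma powerSum_eq_one_tangent (hp : 1 < p) {x₀ : EuclideanSpace ℝ (Fin n)} :
    ∀ ε > 0, ∃ U ∈ nhds x₀, ∀ x ∈ pSphere n p ∩ U, ∀ y ∈ pSphere n p ∩ U,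
      |inner ℝ (WithLp.toLp 2 fun i => |x₀ i| ^ (p - 2) * x₀ i : EuclideanSpace ℝ (Fin n)) (x - y)| ≤
        ε * ‖x - y‖ := by
  intro ε hε
  have hp0 : 0 < p := by linarith
  have h1 : ∀ t : ℝ, HasStrictDerivAt (fun t : ℝ => |t| ^ p) (p * |t| ^ (p - 2) * t) t := by
    intro t
    have hc : ContDiff ℝ 1 (fun t : ℝ => |t| ^ p) := by
      simpa only [Real.norm_eq_abs] using contDiff_norm_rpow (E := ℝ) hp
    exact hc.contDiffAt.hasStrictDerivAt' (hasDerivAt_abs_rpow t hp) one_ne_zero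
  have h2 : HasStrictFDerivAt (powerSum p : EuclideanSpace ℝ (Fin n) → ℝ)
      (∑ i, (p * |x₀ i| ^ (p - 2) * x₀ i) • (EuclideanSpace.proj i : EuclideanSpace ℝ (Fin n) →L[ℝ] ℝ)) x₀ := by
    unfold powerSum
    refine HasStrictFDerivAt.fun_sum fun i _ => ?_
    exact (h1 (x₀ i)).comp_hasStrictFDerivAt x₀
      (EuclideanSpace.proj i : EuclideanSpace ℝ (Fin n) →L[ℝ] ℝ).hasStrictFDerivAt
  have h3 := h2.isLittleO.def (mul_pos hε hp0)
  rw [nhds_prod_eq] at h3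
  obtain ⟨U, hU, hU'⟩ := Filter.eventually_prod_self_iff'.1 h3
  refine ⟨U, hU, fun x hx y hy => ?_⟩
  have h4 := hU' x hx.2 y hy.2
  simp only at h4
  rw [(mem_pSphere_iff hp0).1 hx.1, (mem_pSphere_iff hp0).1 hy.1, sub_self, zero_sub, norm_neg] at h4
  have e : (∑ i, (p * |x₀ i| ^ (p - 2) * x₀ i) • (EuclideanSpace.proj i : EuclideanSpace ℝ (Fin n) →L[ℝ] ℝ)) (x - y)
      = p * inner ℝ (WithLp.toLp 2 fun i => |x₀ i| ^ (p - 2) * x₀ i : EuclideanSpace ℝ (Fin n)) (x - y) := by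
    rw [PiLp.inner_apply, Finset.mul_sum, sum_apply]
    refine Finset.sum_congr rfl fun i _ => ?_
    simp
    ring
  rw [e, Real.norm_eq_abs, abs_mul, abs_of_pos hp0] at h4
  have : p * |inner ℝ (WithLp.toLp 2 fun i => |x₀ i| ^ (p - 2) * x₀ i : EuclideanSpace ℝ (Fin n)) (x - y)| ≤ p * (ε * ‖x - y‖) := by
    linarith
  exact le_of_mul_le_mul_left this hp0

lemma continuous_sqrt_powerSum (hp : 1 ≤ p) :
    Continuous fun x : EuclideanSpace ℝ (Fin n) => √(powerSum (2 * p - 2) x) :=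
  (continuous_powerSum (by linarith)).sqrt

/-- The surface measure on the sphere of the `p`-norm has density proportional to
`√(∑ |x i| ^ (2 * p - 2))` with respect to the cone measure. -/
lemma hausdorff_eq_lintegral_coneMeasure (hn : 1 ≤ n) (hp : 1 ≤ p)
    {A : Set (EuclideanSpace ℝ (Fin n))} (hA : MeasurableSet A) (hAS : A ⊆ pSphere n p) :
    Measure.euclideanHausdorffMeasure (n - 1) A =
      ENNReal.ofReal n * ∫⁻ x in A, ENNReal.ofReal √(powerSum (2 * p - 2) x) ∂(coneMeasure n p) := by
  have hp0 : 0 < p := by linarith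
  have hn0 : (0 : ℝ) < n := by exact_mod_cast hn
  have hβ : ∀ {B : Set (EuclideanSpace ℝ (Fin n))}, MeasurableSet B →
      (ENNReal.ofReal n • (coneMeasure n p).withDensity
      fun x => ENNReal.ofReal √(powerSum (2 * p - 2) x)) B =
      ENNReal.ofReal n * ∫⁻ x in B, ENNReal.ofReal √(powerSum (2 * p - 2) x) ∂(coneMeasure n p) := by
    intro B hB
    rw [Measure.smul_apply, withDensity_apply _ hB, smul_eq_mul]
  rw [← hβ hA]
  rcases hp.eq_or_lt with rfl | hp1
  · obtain ⟨e, he⟩ := exists_surjective_nat (Fin n → Bool)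
    have hc : ∀ x : EuclideanSpace ℝ (Fin n), powerSum (2 * 1 - 2) x = n := by
      intro x; simp [powerSum]
    refine measure_eq_of_cover_comparison (S := pSphere n 1) (fun L hL => ?_) hA hAS
    refine ⟨fun k => {x | ∀ i, |x i| = (if e k i then 1 else -1) * x i}, fun k => ?_, ?_, ?_⟩
    · refine IsClosed.measurableSet ?_
      simp only [Set.ofPred_forall]
      exact isClosed_iInter fun i => isClosed_eq (by fun_prop) (by fun_prop)
    · intro x _
      obtain ⟨k, hk⟩ := he fun i => decide (0 ≤ x i)
      refine mem_iUnion.2 ⟨k, fun i => ?_⟩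
      rw [hk]
      by_cases h : 0 ≤ x i
      · simp [h, abs_of_nonneg]
      · simp [h, abs_of_neg (not_le.1 h)]
    · intro k B hB hBk
      set g : EuclideanSpace ℝ (Fin n) := WithLp.toLp 2 fun i => if e k i then 1 else -1 with hg
      have hgn : ‖g‖ = √n := by
        rw [EuclideanSpace.norm_eq]
        congr 1
        have : ∀ i, ‖g i‖ ^ 2 = 1 := by
          intro i; simp only [hg]; split_ifs <;> simp
        rw [Finset.sum_congr rfl fun i _ => this i]
        simp
      have hg0 : g ≠ 0 := by
        intro h; rw [h, norm_zero] at hgn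
        have := Real.sqrt_pos.2 hn0
        linarith
      have hBg : ∀ x ∈ B, inner ℝ g x = (1 : ℝ) := by
        intro x hx
        have h1 := (mem_pSphere_iff hp0).1 (hBk hx).1
        rw [← h1, PiLp.inner_apply, powerSum]
        refine Finset.sum_congr rfl fun i _ => ?_
        rw [Real.rpow_one, (hBk hx).2 i]
        simp [hg, mul_comm]
      have hv := volume_coneSet_of_inner_eq_one hn hg0 hB hBg
      have e1 : (ENNReal.ofReal n • (coneMeasure n 1).withDensity
          fun x => ENNReal.ofReal √(powerSum (2 * 1 - 2) x)) B =
          Measure.euclideanHausdorffMeasure (n - 1) B := by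
        rw [hβ hB]
        simp_rw [hc]
        rw [setLIntegral_const, coneMeasure_apply hn hp0 hB (hBk.trans inter_subset_left), hv, hgn,
          ← mul_assoc, ← mul_assoc, ← ENNReal.ofReal_mul (by positivity),
          ← ENNReal.ofReal_mul (by positivity)]
        have : (n : ℝ) * √n * (1 / (n * √n)) = 1 := by
          have := Real.sqrt_pos.2 hn0
          field_simp
        rw [this, ENNReal.ofReal_one, one_mul]
      rw [e1]
      have : ∀ b : ℝ≥0∞, b ≤ ENNReal.ofReal L * b := fun b => by
        conv_lhs => rw [← one_mul b]
        gcongr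
        exact ENNReal.one_le_ofReal.2 hL.le
      exact ⟨this _, this _⟩
  · refine measure_eq_of_local_comparison (S := pSphere n p) (fun L hL x₀ hx₀ => ?_) hA hAS
    obtain ⟨K, hK1, hKL⟩ : ∃ K : ℝ, 1 < K ∧ K ^ (2 * n) = L := by
      refine ⟨L ^ (1 / ((2 * n : ℕ) : ℝ)), Real.one_lt_rpow hL (by positivity), ?_⟩
      rw [← Real.rpow_natCast, ← Real.rpow_mul (by linarith)]
      have : 1 / ((2 * n : ℕ) : ℝ) * ((2 * n : ℕ) : ℝ) = 1 := by
        have : ((2 * n : ℕ) : ℝ) ≠ 0 := by positivity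
        field_simp
      rw [this, Real.rpow_one]
    have hK0 : 0 < K := by linarith
    set g : EuclideanSpace ℝ (Fin n) := WithLp.toLp 2 fun i => |x₀ i| ^ (p - 2) * x₀ i with hg
    have hx1 := (mem_pSphere_iff hp0).1 hx₀
    have hgx : inner ℝ g x₀ = (1 : ℝ) := by
      rw [← hx1, PiLp.inner_apply, powerSum]
      refine Finset.sum_congr rfl fun i _ => ?_
      rcases eq_or_ne (x₀ i) 0 with h | h
      · simp [hg, h, Real.zero_rpow hp0.ne']
      · have h' : 0 < |x₀ i| := abs_pos.2 h
        have : |x₀ i| ^ p = |x₀ i| ^ (p - 2) * |x₀ i| ^ 2 := by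
          rw [← Real.rpow_natCast, ← Real.rpow_add h']; congr 1; push_cast; ring
        rw [this, sq_abs]
        simp [hg]; ring
    have hgn : ‖g‖ = √(powerSum (2 * p - 2) x₀) := by
      rw [EuclideanSpace.norm_eq, powerSum]
      congr 1
      refine Finset.sum_congr rfl fun i _ => ?_
      rcases eq_or_ne (x₀ i) 0 with h | h
      · have : 2 * p - 2 ≠ 0 := by linarith
        simp [hg, h, Real.zero_rpow this]
      · have h' : 0 < |x₀ i| := abs_pos.2 h
        have e1 : |x₀ i| ^ (2 * p - 2) = (|x₀ i| ^ (p - 2)) ^ 2 * |x₀ i| ^ 2 := by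
          rw [← Real.rpow_natCast, ← Real.rpow_natCast, ← Real.rpow_mul h'.le, ← Real.rpow_add h']
          congr 1; push_cast; ring
        rw [e1, Real.norm_eq_abs, sq_abs, sq_abs]
        simp [hg]; ring
    have hg0 : 0 < ‖g‖ := norm_pos_iff.2 (by rintro h; rw [h] at hgx; simp at hgx)
    obtain ⟨U, hU, hcomp⟩ := exists_nhds_hausdorff_cone_comparison hn hgx
      (powerSum_eq_one_tangent hp1) hK1
    have hc := (continuous_sqrt_powerSum (n := n) hp).continuousAt (x := x₀)
    have hlt : √(powerSum (2 * p - 2) x₀) < K * ‖g‖ := by rw [← hgn]; nlinarith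
    have hgt : K⁻¹ * ‖g‖ < √(powerSum (2 * p - 2) x₀) := by
      rw [← hgn]
      have := inv_lt_one_of_one_lt₀ hK1
      nlinarith
    refine ⟨U ∩ ({x | √(powerSum (2 * p - 2) x) < K * ‖g‖} ∩ {x | K⁻¹ * ‖g‖ < √(powerSum (2 * p - 2) x)}),
      Filter.inter_mem hU (Filter.inter_mem (hc.eventually (gt_mem_nhds hlt))
        (hc.eventually (lt_mem_nhds hgt))), fun B hB hBU => ?_⟩
    obtain ⟨h1, h2⟩ := hcomp B hB fun x hx => ⟨(hBU hx).1, (hBU hx).2.1⟩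
    have hcone := coneMeasure_apply hn hp0 hB fun x hx => (hBU hx).1
    rw [← hcone] at h1 h2
    have u1 : ∫⁻ x in B, ENNReal.ofReal √(powerSum (2 * p - 2) x) ∂(coneMeasure n p) ≤
        ENNReal.ofReal (K * ‖g‖) * coneMeasure n p B := by
      rw [← setLIntegral_const]
      exact setLIntegral_mono' hB fun x hx => ENNReal.ofReal_le_ofReal (hBU hx).2.2.1.le
    have u2 : ENNReal.ofReal (K⁻¹ * ‖g‖) * coneMeasure n p B ≤
        ∫⁻ x in B, ENNReal.ofReal √(powerSum (2 * p - 2) x) ∂(coneMeasure n p) := by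
      rw [← setLIntegral_const]
      exact setLIntegral_mono' hB fun x hx => ENNReal.ofReal_le_ofReal (hBU hx).2.2.2.le
    rw [hβ hB]
    have hKK : K ^ (2 * n) = K ^ (2 * n - 1) * K := by rw [← pow_succ]; congr 1; omega
    constructor
    · refine h1.trans ?_
      calc _ = ENNReal.ofReal L * (ENNReal.ofReal n * (ENNReal.ofReal (K⁻¹ * ‖g‖) * coneMeasure n p B)) := by
            have hL0 : 0 ≤ L := by linarith
            rw [← mul_assoc (ENNReal.ofReal n), ← mul_assoc (ENNReal.ofReal L),
              ← ENNReal.ofReal_mul hn0.le, ← ENNReal.ofReal_mul hL0, ← hKL, hKK]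
            congr 2
            field_simp
        _ ≤ _ := by gcongr
    · calc _ ≤ ENNReal.ofReal n * (ENNReal.ofReal (K * ‖g‖) * coneMeasure n p B) := by gcongr
        _ = ENNReal.ofReal K * (ENNReal.ofReal (n * ‖g‖) * coneMeasure n p B) := by
          rw [← mul_assoc, ← mul_assoc, ← ENNReal.ofReal_mul (by positivity),
              ← ENNReal.ofReal_mul (by positivity)]
          congr 2
          ring
        _ ≤ ENNReal.ofReal K * (ENNReal.ofReal (K ^ (2 * n - 1)) * Measure.euclideanHausdorffMeasure (n - 1) B) := by
          gcongr
        _ = _ := by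
          rw [← mul_assoc, ← ENNReal.ofReal_mul (by positivity), ← hKL, hKK, mul_comm K]

end Density

section Polar

variable {n : ℕ} {p : ℝ}

lemma volume_powerSum_le_one_lt_top (hp : 0 < p) :
    volume {x : EuclideanSpace ℝ (Fin n) | powerSum p x ≤ 1} < ⊤ := by
  refine (measure_mono (t := Metric.closedBall 0 √n) fun x hx => ?_).trans_lt measure_closedBall_lt_top
  rw [mem_closedBall_zero_iff, EuclideanSpace.norm_eq]
  refine Real.sqrt_le_sqrt ?_
  have : ∀ i ∈ Finset.univ, ‖x i‖ ^ 2 ≤ (1 : ℝ) := by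
    intro i _
    have h1 : |x i| ^ p ≤ 1 := (Finset.single_le_sum (f := fun i => |x i| ^ p)
      (fun i _ => Real.rpow_nonneg (abs_nonneg _) _) (Finset.mem_univ i)).trans hx
    have h2 : |x i| ≤ 1 := by
      by_contra! h
      linarith [Real.one_lt_rpow h hp]
    rw [Real.norm_eq_abs]
    exact pow_le_one₀ (abs_nonneg _) h2
  simpa using Finset.sum_le_sum this

lemma coneMeasure_univ (hp : 0 ≤ p) :
    coneMeasure n p univ = volume {x : EuclideanSpace ℝ (Fin n) | powerSum p x ≤ 1} := by
  rw [coneMeasure, Measure.map_apply (measurable_radialProj hp) .univ]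
  simp

lemma isFiniteMeasure_coneMeasure (hp : 0 < p) : IsFiniteMeasure (coneMeasure n p) :=
  ⟨by rw [coneMeasure_univ hp.le]; exact volume_powerSum_le_one_lt_top hp⟩

open scoped Pointwise in
lemma volume_radialProj_preimage (hp : 0 < p) {A : Set (EuclideanSpace ℝ (Fin n))}
    (hA : MeasurableSet A) {u : ℝ} (hu : 0 < u) :
    volume (radialProj p ⁻¹' A ∩ {x | powerSum p x ≤ u}) =
      ENNReal.ofReal (u ^ (n / p : ℝ)) * coneMeasure n p A := by
  set c := u ^ (1 / p) with hc
  have hc0 : 0 < c := by positivity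
  have hcp : c ^ p = u := by
    rw [hc, ← Real.rpow_mul hu.le]
    have : 1 / p * p = 1 := by field_simp
    rw [this, Real.rpow_one]
  have e : radialProj p ⁻¹' A ∩ {x | powerSum p x ≤ u} =
      c • (radialProj p ⁻¹' A ∩ {x | powerSum p x ≤ 1}) := by
    ext x
    rw [mem_smul_set_iff_inv_smul_mem₀ hc0.ne']
    simp only [mem_inter_iff, mem_preimage, mem_ofPred_eq, radialProj_smul hp (inv_pos.2 hc0),
      powerSum_smul (inv_pos.2 hc0).le, Real.inv_rpow hc0.le, hcp, inv_mul_le_iff₀ hu, mul_one]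
  rw [e, Measure.addHaar_smul, finrank_euclideanSpace_fin, abs_of_pos (by positivity), coneMeasure,
    Measure.map_apply (measurable_radialProj hp.le) hA,
    Measure.restrict_apply (measurable_radialProj hp.le hA)]
  congr 2
  rw [hc, ← Real.rpow_natCast, ← Real.rpow_mul hu.le]
  congr 1
  ring

/-- The measure on `(0, ∞)` with density `s * u ^ (s - 1)`. -/
noncomputable def radialMeasure (s : ℝ) : Measure ℝ :=
  (volume.restrict (Ioi 0)).withDensity fun u => ENNReal.ofReal (s * u ^ (s - 1))

lemma radialMeasure_Iic {s u : ℝ} (hs : 0 < s) (hu : 0 < u) :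
    radialMeasure s (Iic u) = ENNReal.ofReal (u ^ s) := by
  rw [radialMeasure, withDensity_apply _ measurableSet_Iic, Measure.restrict_restrict measurableSet_Iic,
    Iic_inter_Ioi, ← ofReal_integral_eq_lintegral_ofReal,
    ← intervalIntegral.integral_of_le hu.le, intervalIntegral.integral_const_mul,
    integral_rpow (Or.inl (by linarith))]
  · congr 1
    rw [sub_add_cancel, Real.zero_rpow hs.ne']
    field_simp
    ring
  · have := (intervalIntegral.intervalIntegrable_rpow' (a := 0) (b := u) (r := s - 1) (by linarith)).const_mul s
    rwa [intervalIntegrable_iff_integrableOn_Ioc_of_le hu.le] at this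
  · filter_upwards [ae_restrict_mem measurableSet_Ioc] with x hx
    have := hx.1
    simp only [Pi.zero_apply]
    positivity

lemma radialMeasure_Iic_of_nonpos {s u : ℝ} (hu : u ≤ 0) : radialMeasure s (Iic u) = 0 := by
  rw [radialMeasure, withDensity_apply _ measurableSet_Iic, Measure.restrict_restrict measurableSet_Iic,
    Iic_inter_Ioi, Ioc_eq_empty (not_lt.2 hu)]
  simp

lemma sigmaFinite_radialMeasure (s : ℝ) : SigmaFinite (radialMeasure s) :=
  SigmaFinite.withDensity_ofReal _

/-- Polar coordinates for the `p`-norm. -/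
lemma map_radialProj_powerSum (hn : 1 ≤ n) (hp : 0 < p) :
    (volume : Measure (EuclideanSpace ℝ (Fin n))).map (fun x => (radialProj p x, powerSum p x)) =
      (coneMeasure n p).prod (radialMeasure (n / p)) := by
  have hs : (0 : ℝ) < n / p := by
    have : (0 : ℝ) < n := by exact_mod_cast hn
    positivity
  have := isFiniteMeasure_coneMeasure (n := n) hp
  have := sigmaFinite_radialMeasure (n / p)
  have hF := (continuous_powerSum (n := n) hp.le).measurable
  have hπ := measurable_radialProj (n := n) hp.le
  symm
  refine Measure.prod_eq fun A t hA ht => ?_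
  rw [Measure.map_apply (hπ.prodMk hF) (hA.prod ht)]
  set μ : Measure ℝ := (volume.restrict (radialProj p ⁻¹' A)).map (powerSum p) with hμ
  have hIic : ∀ u, μ (Iic u) = coneMeasure n p A * radialMeasure (n / p) (Iic u) := by
    intro u
    rw [hμ, Measure.map_apply hF measurableSet_Iic, Measure.restrict_apply (hF measurableSet_Iic)]
    rcases lt_or_ge 0 u with hu | hu
    · rw [radialMeasure_Iic hs hu, mul_comm, ← volume_radialProj_preimage hp hA hu, inter_comm]
      rfl
    · rw [radialMeasure_Iic_of_nonpos hu, mul_zero]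
      refine measure_mono_null inter_subset_left ?_
      have : ∀ᵐ x : EuclideanSpace ℝ (Fin n), x ∉ powerSum p ⁻¹' Iic u := by
        filter_upwards [ae_ne_zero hn] with x hx h
        have h1 := powerSum_pos hp hx
        have h2 : powerSum p x ≤ u := h
        linarith
      exact measure_eq_zero_iff_ae_notMem.2 this
  have hfin : ∀ u, radialMeasure (n / p) (Iic u) ≠ ⊤ := by
    intro u
    rcases lt_or_ge 0 u with hu | hu
    · rw [radialMeasure_Iic hs hu]; exact ENNReal.ofReal_ne_top
    · rw [radialMeasure_Iic_of_nonpos hu]; simp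
  have hfin' : ∀ u, μ (Iic u) ≠ ⊤ := fun u => by
    rw [hIic]; exact ENNReal.mul_ne_top (measure_ne_top _ _) (hfin u)
  have : IsLocallyFiniteMeasure μ := ⟨fun x => ⟨Iic (x + 1), Iic_mem_nhds (by linarith),
    (hfin' _).lt_top⟩⟩
  have hμeq : μ = coneMeasure n p A • radialMeasure (n / p) := by
    refine Measure.ext_of_Ioc _ _ fun a b hab => ?_
    have e : Ioc a b = Iic b \ Iic a := by ext; simp [and_comm]
    rw [e, Measure.smul_apply, measure_sdiff (Iic_subset_Iic.2 hab.le) measurableSet_Iic.nullMeasurableSet (hfin' a),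
      measure_sdiff (Iic_subset_Iic.2 hab.le) measurableSet_Iic.nullMeasurableSet (hfin a), hIic, hIic,
      smul_eq_mul, ENNReal.mul_sub]
    intro _ _; exact measure_ne_top _ _
  have h := congrArg (fun m : Measure ℝ => m t) hμeq
  simp only [hμ, Measure.smul_apply, smul_eq_mul] at h
  rw [Measure.map_apply hF ht, Measure.restrict_apply (hF ht)] at h
  rw [← h, inter_comm]
  rfl

lemma integral_radialProj_mul_powerSum (hn : 1 ≤ n) (hp : 0 < p)
    {φ : EuclideanSpace ℝ (Fin n) → ℝ} (hφ : Measurable φ) {r : ℝ} (hr : 0 < n / p + r) :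
    ∫ x, φ (radialProj p x) * (powerSum p x ^ r * Real.exp (-powerSum p x)) =
      (∫ x, φ x ∂(coneMeasure n p)) * (n / p * Real.Gamma (n / p + r)) := by
  have hs : (0 : ℝ) < n / p := by
    have : (0 : ℝ) < n := by exact_mod_cast hn
    positivity
  have := isFiniteMeasure_coneMeasure (n := n) hp
  have := sigmaFinite_radialMeasure (n / p)
  have hF := (continuous_powerSum (n := n) hp.le).measurable
  have hπ := measurable_radialProj (n := n) hp.le
  have h1 := integral_map (μ := (volume : Measure (EuclideanSpace ℝ (Fin n)))) (hπ.prodMk hF).aemeasurable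
    (f := fun z : EuclideanSpace ℝ (Fin n) × ℝ => φ z.1 * (z.2 ^ r * Real.exp (-z.2)))
    (by fun_prop)
  simp only at h1
  rw [← h1, map_radialProj_powerSum hn hp,
    integral_prod_mul (f := φ) (g := fun u : ℝ => u ^ r * Real.exp (-u))]
  congr 1
  rw [radialMeasure, integral_withDensity_eq_integral_toReal_smul (by fun_prop)
    (.of_forall fun _ => ENNReal.ofReal_lt_top), Real.Gamma_eq_integral hr, ← integral_const_mul]
  refine setIntegral_congr_fun measurableSet_Ioi fun u hu => ?_
  have hu0 : 0 < u := hu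
  simp only [smul_eq_mul]
  rw [ENNReal.toReal_ofReal (by positivity)]
  have : u ^ (n / p + r - 1) = u ^ (n / p - 1) * u ^ r := by
    rw [← Real.rpow_add hu0]; congr 1; ring
  rw [this]
  ring

end Polar

section Moments

variable {n : ℕ} {p : ℝ}

lemma integral_abs_rpow_mul_exp (hp : 0 < p) {r : ℝ} (hr : 0 ≤ r) :
    ∫ t : ℝ, |t| ^ (p * r) * Real.exp (-|t| ^ p) = 2 / p * Real.Gamma (1 / p + r) := by
  have h := integral_comp_abs (f := fun t : ℝ => t ^ (p * r) * Real.exp (-t ^ p))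
  have : 0 ≤ p * r := by positivity
  rw [h, integral_rpow_mul_exp_neg_rpow hp (by linarith)]
  have : (p * r + 1) / p = 1 / p + r := by field_simp; ring
  rw [this]
  ring

lemma exp_neg_powerSum (x : EuclideanSpace ℝ (Fin n)) :
    Real.exp (-powerSum p x) = ∏ i, Real.exp (-|x i| ^ p) := by
  rw [powerSum, ← Finset.sum_neg_distrib, Real.exp_sum]

lemma integral_prod_coord (f : Fin n → ℝ → ℝ) :
    ∫ x : EuclideanSpace ℝ (Fin n), ∏ i, f i (x i) = ∏ i, ∫ t, f i t := by
  rw [← integral_fintype_prod_volume_eq_prod]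
  exact (EuclideanSpace.volume_preserving_symm_measurableEquiv_toLp (Fin n)).integral_comp
    (MeasurableEquiv.measurableEmbedding _) (fun y : Fin n → ℝ => ∏ i, f i (y i))

lemma integral_exp_neg_powerSum (hp : 0 < p) :
    ∫ x : EuclideanSpace ℝ (Fin n), Real.exp (-powerSum p x) = (2 / p * Real.Gamma (1 / p)) ^ n := by
  simp_rw [exp_neg_powerSum]
  rw [integral_prod_coord (fun _ t => Real.exp (-|t| ^ p)), Finset.prod_const]
  have := integral_abs_rpow_mul_exp hp (r := 0) le_rfl
  simp only [mul_zero, Real.rpow_zero, one_mul, add_zero] at this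
  rw [this]
  simp

lemma integral_pair_mul_exp (hp : 0 < p) {r : ℝ} (hr : 0 ≤ r) (i k : Fin n) :
    ∫ x : EuclideanSpace ℝ (Fin n), |x i| ^ (p * r) * |x k| ^ (p * r) * Real.exp (-powerSum p x) =
      (2 / p * Real.Gamma (1 / p)) ^ n * (if i = k then Real.Gamma (1 / p + 2 * r) / Real.Gamma (1 / p)
        else (Real.Gamma (1 / p + r) / Real.Gamma (1 / p)) ^ 2) := by
  have hΓ : 0 < Real.Gamma (1 / p) := Real.Gamma_pos_of_pos (by positivity)
  have e : ∀ x : EuclideanSpace ℝ (Fin n), |x i| ^ (p * r) * |x k| ^ (p * r) * Real.exp (-powerSum p x) =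
      ∏ j, ((if j = i then |x j| ^ (p * r) else 1) * (if j = k then |x j| ^ (p * r) else 1) *
        Real.exp (-|x j| ^ p)) := by
    intro x
    rw [Finset.prod_mul_distrib, Finset.prod_mul_distrib, exp_neg_powerSum]
    simp
  simp_rw [e]
  rw [integral_prod_coord fun j t => (if j = i then |t| ^ (p * r) else 1) * (if j = k then |t| ^ (p * r) else 1) *
        Real.exp (-|t| ^ p)]
  have h0 := integral_abs_rpow_mul_exp hp (r := 0) le_rfl
  simp only [mul_zero, Real.rpow_zero, one_mul, add_zero] at h0
  have h1 := integral_abs_rpow_mul_exp hp hr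
  have h2 := integral_abs_rpow_mul_exp hp (r := 2 * r) (by positivity)
  have h2' : ∫ t : ℝ, |t| ^ (p * r) * |t| ^ (p * r) * Real.exp (-|t| ^ p) = 2 / p * Real.Gamma (1 / p + 2 * r) := by
    rw [← h2]
    congr 1
    ext t
    rw [← Real.rpow_add_of_nonneg (abs_nonneg _) (by positivity) (by positivity)]
    congr 2
    ring
  rcases eq_or_ne i k with rfl | hik
  · have : ∀ j, ∫ t : ℝ, (if j = i then |t| ^ (p * r) else 1) * (if j = i then |t| ^ (p * r) else 1) *
        Real.exp (-|t| ^ p) = 2 / p * Real.Gamma (1 / p) *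
          (if j = i then Real.Gamma (1 / p + 2 * r) / Real.Gamma (1 / p) else 1) := by
      intro j
      by_cases hj : j = i
      · simp only [hj, if_true]; rw [h2']; field_simp
      · simp only [hj, if_false, one_mul, mul_one]; exact h0
    rw [Finset.prod_congr rfl fun j _ => this j, Finset.prod_mul_distrib]
    simp
  · have : ∀ j, ∫ t : ℝ, (if j = i then |t| ^ (p * r) else 1) * (if j = k then |t| ^ (p * r) else 1) *
        Real.exp (-|t| ^ p) = 2 / p * Real.Gamma (1 / p) *
          ((if j = i then Real.Gamma (1 / p + r) / Real.Gamma (1 / p) else 1) *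
           (if j = k then Real.Gamma (1 / p + r) / Real.Gamma (1 / p) else 1)) := by
      intro j
      by_cases hj : j = i
      · have hj' : j ≠ k := by rw [hj]; exact hik
        simp only [hj, hik, if_true, if_false, mul_one]; rw [h1]; field_simp
      · by_cases hjk : j = k
        · have hki : k ≠ i := hik.symm
          simp only [hjk, hki, if_true, if_false, one_mul]; rw [h1]; field_simp
        · simp only [hj, hjk, if_false, one_mul, mul_one]; exact h0
    rw [Finset.prod_congr rfl fun j _ => this j, Finset.prod_mul_distrib, Finset.prod_const,
      Finset.card_univ, Fintype.card_fin, Finset.prod_mul_distrib, Finset.prod_ite_eq', Finset.prod_ite_eq',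
      if_pos (Finset.mem_univ _), if_pos (Finset.mem_univ _), if_neg hik, sq]

lemma integral_coord_mul_exp (hp : 0 < p) {r : ℝ} (hr : 0 ≤ r) (i : Fin n) :
    ∫ x : EuclideanSpace ℝ (Fin n), |x i| ^ (p * r) * Real.exp (-powerSum p x) =
      (2 / p * Real.Gamma (1 / p)) ^ n * (Real.Gamma (1 / p + r) / Real.Gamma (1 / p)) := by
  have h := integral_pair_mul_exp hp (r := r / 2) (by positivity) i i
  rw [if_pos rfl, mul_div_cancel₀ r two_ne_zero] at h
  rw [← h]
  congr 1
  ext x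
  rw [← Real.rpow_add_of_nonneg (abs_nonneg _) (by positivity) (by positivity)]
  congr 2
  ring

lemma integral_powerSum_mul_exp (hp : 0 < p) {r : ℝ} (hr : 0 ≤ r) :
    ∫ x : EuclideanSpace ℝ (Fin n), powerSum (p * r) x * Real.exp (-powerSum p x) =
      (2 / p * Real.Gamma (1 / p)) ^ n * (n * (Real.Gamma (1 / p + r) / Real.Gamma (1 / p))) := by
  have hΓ : 0 < Real.Gamma (1 / p) := Real.Gamma_pos_of_pos (by positivity)
  have hΓ' : 0 < Real.Gamma (1 / p + r) := Real.Gamma_pos_of_pos (by positivity)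
  have e : ∀ x : EuclideanSpace ℝ (Fin n), powerSum (p * r) x * Real.exp (-powerSum p x) =
      ∑ i, |x i| ^ (p * r) * Real.exp (-powerSum p x) := fun x => by
    rw [powerSum, Finset.sum_mul]
  simp_rw [e]
  rw [integral_finsetSum]
  · rw [Finset.sum_congr rfl fun i _ => integral_coord_mul_exp hp hr i]
    simp
    ring
  · intro i _
    refine Integrable.of_integral_ne_zero ?_
    rw [integral_coord_mul_exp hp hr i]
    positivity

lemma integral_powerSum_sq_mul_exp (hp : 0 < p) {r : ℝ} (hr : 0 ≤ r) :
    ∫ x : EuclideanSpace ℝ (Fin n), powerSum (p * r) x ^ 2 * Real.exp (-powerSum p x) =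
      (2 / p * Real.Gamma (1 / p)) ^ n * (n * (Real.Gamma (1 / p + 2 * r) / Real.Gamma (1 / p) -
        (Real.Gamma (1 / p + r) / Real.Gamma (1 / p)) ^ 2) +
        n ^ 2 * (Real.Gamma (1 / p + r) / Real.Gamma (1 / p)) ^ 2) := by
  have hΓ : 0 < Real.Gamma (1 / p) := Real.Gamma_pos_of_pos (by positivity)
  have hΓ' : 0 < Real.Gamma (1 / p + r) := Real.Gamma_pos_of_pos (by positivity)
  have hΓ2 : 0 < Real.Gamma (1 / p + 2 * r) := Real.Gamma_pos_of_pos (by positivity)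
  have e : ∀ x : EuclideanSpace ℝ (Fin n), powerSum (p * r) x ^ 2 * Real.exp (-powerSum p x) =
      ∑ z : Fin n × Fin n, |x z.1| ^ (p * r) * |x z.2| ^ (p * r) * Real.exp (-powerSum p x) := fun x => by
    rw [powerSum, sq, Finset.sum_mul_sum, Finset.sum_mul, Fintype.sum_prod_type]
    simp_rw [Finset.sum_mul]
  simp_rw [e]
  rw [integral_finsetSum]
  · rw [Finset.sum_congr rfl fun z _ => integral_pair_mul_exp hp hr z.1 z.2, ← Finset.mul_sum]
    congr 1
    set v := Real.Gamma (1 / p + 2 * r) / Real.Gamma (1 / p)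
    set m := Real.Gamma (1 / p + r) / Real.Gamma (1 / p)
    have : ∀ z : Fin n × Fin n, (if z.1 = z.2 then v else m ^ 2) =
        (if z.1 = z.2 then v - m ^ 2 else 0) + m ^ 2 := fun z => by split_ifs <;> ring
    rw [Finset.sum_congr rfl fun z _ => this z, Finset.sum_add_distrib, Fintype.sum_prod_type]
    simp
    ring
  · intro z _
    refine Integrable.of_integral_ne_zero ?_
    rw [integral_pair_mul_exp hp hr]
    split_ifs <;> positivity

lemma powerSum_mul_eq (hp : 0 < p) (r : ℝ) {x : EuclideanSpace ℝ (Fin n)} (hx : x ≠ 0) :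
    powerSum (p * r) x = powerSum (p * r) (radialProj p x) * powerSum p x ^ r := by
  have h := powerSum_pos hp hx
  conv_lhs => rw [← rpow_smul_radialProj hp hx]
  rw [powerSum_smul (by positivity), ← Real.rpow_mul h.le, mul_comm]
  congr 2
  field_simp

lemma integral_powerSum_coneMeasure (hn : 1 ≤ n) (hp : 0 < p) {r : ℝ} (hr : 0 ≤ r) :
    ∫ x, powerSum (p * r) x ∂(coneMeasure n p) = (coneMeasure n p).real univ *
      (n * (Real.Gamma (1 / p + r) / Real.Gamma (1 / p))) *
      (Real.Gamma (n * (1 / p)) / Real.Gamma (n * (1 / p) + r)) := by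
  have hn0 : (0 : ℝ) < n := by exact_mod_cast hn
  have hs : (0 : ℝ) < n / p := by positivity
  have hm : Measurable (powerSum (p * r) : EuclideanSpace ℝ (Fin n) → ℝ) :=
    (continuous_powerSum (by positivity)).measurable
  have h0 := integral_radialProj_mul_powerSum hn hp (φ := fun _ => 1) measurable_const (r := 0) (by linarith)
  simp only [Real.rpow_zero, one_mul, integral_const, smul_eq_mul, mul_one, add_zero] at h0
  rw [integral_exp_neg_powerSum hp] at h0
  have h1 := integral_radialProj_mul_powerSum hn hp hm (r := r) (by linarith)
  have e : ∫ x : EuclideanSpace ℝ (Fin n), powerSum (p * r) (radialProj p x) *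
      (powerSum p x ^ r * Real.exp (-powerSum p x)) =
      ∫ x : EuclideanSpace ℝ (Fin n), powerSum (p * r) x * Real.exp (-powerSum p x) := by
    refine integral_congr_ae ?_
    filter_upwards [ae_ne_zero hn] with x hx
    rw [powerSum_mul_eq hp r hx, mul_assoc]
  rw [e, integral_powerSum_mul_exp hp hr, h0] at h1
  have hg : 0 < Real.Gamma (n / p + r) := Real.Gamma_pos_of_pos (by linarith)
  have hne : (n / p : ℝ) * Real.Gamma (n / p + r) ≠ 0 := by positivity
  rw [eq_comm, ← eq_div_iff hne] at h1
  rw [h1, mul_one_div]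
  field_simp

lemma integral_powerSum_sq_coneMeasure (hn : 1 ≤ n) (hp : 0 < p) {r : ℝ} (hr : 0 ≤ r) :
    ∫ x, powerSum (p * r) x ^ 2 ∂(coneMeasure n p) = (coneMeasure n p).real univ *
      (n * (Real.Gamma (1 / p + 2 * r) / Real.Gamma (1 / p) -
        (Real.Gamma (1 / p + r) / Real.Gamma (1 / p)) ^ 2) +
        n ^ 2 * (Real.Gamma (1 / p + r) / Real.Gamma (1 / p)) ^ 2) *
      (Real.Gamma (n * (1 / p)) / Real.Gamma (n * (1 / p) + 2 * r)) := by
  have hn0 : (0 : ℝ) < n := by exact_mod_cast hn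
  have hs : (0 : ℝ) < n / p := by positivity
  have hm : Measurable (fun x : EuclideanSpace ℝ (Fin n) => powerSum (p * r) x ^ 2) :=
    (continuous_powerSum (by positivity)).measurable.pow_const 2
  have h0 := integral_radialProj_mul_powerSum hn hp (φ := fun _ => 1) measurable_const (r := 0) (by linarith)
  simp only [Real.rpow_zero, one_mul, integral_const, smul_eq_mul, mul_one, add_zero] at h0
  rw [integral_exp_neg_powerSum hp] at h0
  have h1 := integral_radialProj_mul_powerSum hn hp hm (r := 2 * r) (by linarith)
  have e : ∫ x : EuclideanSpace ℝ (Fin n), powerSum (p * r) (radialProj p x) ^ 2 *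
      (powerSum p x ^ (2 * r) * Real.exp (-powerSum p x)) =
      ∫ x : EuclideanSpace ℝ (Fin n), powerSum (p * r) x ^ 2 * Real.exp (-powerSum p x) := by
    refine integral_congr_ae ?_
    filter_upwards [ae_ne_zero hn] with x hx
    have : powerSum p x ^ (2 * r) = (powerSum p x ^ r) ^ 2 := by
      rw [← Real.rpow_natCast, ← Real.rpow_mul (powerSum_nonneg x)]; congr 1; push_cast; ring
    rw [powerSum_mul_eq hp r hx, this]
    ring
  rw [e, integral_powerSum_sq_mul_exp hp hr, h0] at h1
  have hg : 0 < Real.Gamma (n / p + 2 * r) := Real.Gamma_pos_of_pos (by linarith)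
  have hne : (n / p : ℝ) * Real.Gamma (n / p + 2 * r) ≠ 0 := by positivity
  rw [eq_comm, ← eq_div_iff hne] at h1
  rw [h1, mul_one_div]
  generalize Real.Gamma (1 / p + 2 * r) / Real.Gamma (1 / p) = v
  generalize Real.Gamma (1 / p + r) / Real.Gamma (1 / p) = m
  field_simp

end Moments

section Comparison

variable {n : ℕ} {p : ℝ}

lemma coneMeasure_real_univ_pos (hp : 0 < p) : 0 < (coneMeasure n p).real univ := by
  have := isFiniteMeasure_coneMeasure (n := n) hp
  refine ENNReal.toReal_pos ?_ (measure_ne_top _ _)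
  rw [coneMeasure_univ hp.le]
  have ho : IsOpen {x : EuclideanSpace ℝ (Fin n) | powerSum p x < 1} :=
    isOpen_lt (continuous_powerSum hp.le) continuous_const
  have h := ho.measure_pos volume ⟨0, by simp [powerSum_zero hp]⟩
  exact (h.trans_le (measure_mono fun x (hx : powerSum p x < 1) => hx.le)).ne'

lemma abs_apply_le_one (hp : 0 < p) {x : EuclideanSpace ℝ (Fin n)} (hx : powerSum p x = 1) (i : Fin n) :
    |x i| ≤ 1 := by
  have h1 : |x i| ^ p ≤ 1 := (Finset.single_le_sum (f := fun i => |x i| ^ p)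
    (fun i _ => Real.rpow_nonneg (abs_nonneg _) _) (Finset.mem_univ i)).trans hx.le
  by_contra! h
  linarith [Real.one_lt_rpow h hp]

lemma powerSum_anti (hp : 0 < p) {x : EuclideanSpace ℝ (Fin n)} (hx : powerSum p x = 1) {r s : ℝ}
    (hr : 0 < r) (hrs : r ≤ s) : powerSum s x ≤ powerSum r x :=
  Finset.sum_le_sum fun i _ => Real.rpow_le_rpow_of_exponent_ge_of_imp (abs_nonneg _)
    (abs_apply_le_one hp hx i) hrs fun _ h => absurd h (hr.trans_le hrs).ne'

lemma powerSum_le_card (hp : 0 < p) {x : EuclideanSpace ℝ (Fin n)} (hx : powerSum p x = 1) {r : ℝ}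
    (hr : 0 ≤ r) : powerSum r x ≤ n := by
  have : ∀ i ∈ Finset.univ, |x i| ^ r ≤ 1 := fun i _ =>
    Real.rpow_le_one (abs_nonneg _) (abs_apply_le_one hp hx i) hr
  simpa [powerSum] using Finset.sum_le_sum this

lemma integrable_powerSum_pow (hn : 1 ≤ n) (hp : 0 < p) {r : ℝ} (hr : 0 ≤ r) (k : ℕ) :
    Integrable (fun x => powerSum r x ^ k) (coneMeasure n p) := by
  have := isFiniteMeasure_coneMeasure (n := n) hp
  refine Integrable.of_bound ((continuous_powerSum hr).pow k).aestronglyMeasurable ((n : ℝ) ^ k) ?_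
  filter_upwards [ae_coneMeasure hn hp] with x hx
  rw [Real.norm_eq_abs, abs_of_nonneg (pow_nonneg (powerSum_nonneg x) k)]
  exact pow_le_pow_left₀ (powerSum_nonneg x) (powerSum_le_card hp hx hr) k

lemma integral_powerSum_sq_le (hn : 1 ≤ n) (hp : 2 ≤ p) :
    ∫ x, powerSum (2 * p - 2) x ^ 2 ∂(coneMeasure n p) ≤
      ∫ x, powerSum (2 * p - 2) x ∂(coneMeasure n p) := by
  have hp0 : 0 < p := by linarith
  have hr : 0 ≤ 2 * p - 2 := by linarith
  refine integral_mono_ae (integrable_powerSum_pow hn hp0 hr 2)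
    (by simpa using integrable_powerSum_pow hn hp0 hr 1) ?_
  filter_upwards [ae_coneMeasure hn hp0] with x hx
  have h1 : powerSum (2 * p - 2) x ≤ 1 := (powerSum_anti hp0 hx hp0 (by linarith)).trans hx.le
  have h0 : 0 ≤ powerSum (2 * p - 2) x := powerSum_nonneg x
  change powerSum (2 * p - 2) x ^ 2 ≤ powerSum (2 * p - 2) x
  nlinarith

lemma le_integral_powerSum (hn : 1 ≤ n) (hp : 1 < p) :
    (coneMeasure n p).real univ ≤
      (1 + n * (1 / p)) * ∫ x, powerSum (2 * p - 2) x ∂(coneMeasure n p) := by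
  have hp0 : 0 < p := by linarith
  have hn0 : (0 : ℝ) < n := by exact_mod_cast hn
  have h : ∫ x, powerSum (p * 2) x ∂(coneMeasure n p) ≤
      ∫ x, powerSum (2 * p - 2) x ∂(coneMeasure n p) := by
    refine integral_mono_ae (by simpa using integrable_powerSum_pow hn hp0 (r := p * 2) (by linarith) 1)
      (by simpa using integrable_powerSum_pow hn hp0 (r := 2 * p - 2) (by linarith) 1) ?_
    filter_upwards [ae_coneMeasure hn hp0] with x hx
    exact powerSum_anti hp0 hx (by linarith) (by linarith)
  rw [integral_powerSum_coneMeasure hn hp0 (by norm_num)] at h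
  have hM := coneMeasure_real_univ_pos (n := n) hp0
  set M := (coneMeasure n p).real univ
  set a := 1 / p
  have ha : 0 < a := by positivity
  have g : ∀ {s : ℝ}, 0 < s → Real.Gamma (s + 2) = (s + 1) * (s * Real.Gamma s) := fun {s} hs => by
    rw [show s + 2 = s + 1 + 1 by ring, Real.Gamma_add_one (by positivity), Real.Gamma_add_one hs.ne']
  have hna : 0 < n * a := by positivity
  rw [g ha, g hna] at h
  have g1 := Real.Gamma_pos_of_pos ha
  have g2 := Real.Gamma_pos_of_pos hna
  have e : M * (n * ((a + 1) * (a * Real.Gamma a) / Real.Gamma a)) *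
      (Real.Gamma (n * a) / ((n * a + 1) * (n * a * Real.Gamma (n * a)))) = M * (a + 1) / (1 + n * a) := by
    field_simp
    ring
  rw [e, div_le_iff₀ (by positivity)] at h
  nlinarith

lemma variance_powerSum_le (hn : 1 ≤ n) (hp : 1 ≤ p) :
    (∫ x, powerSum (2 * p - 2) x ^ 2 ∂(coneMeasure n p)) * (coneMeasure n p).real univ -
      (∫ x, powerSum (2 * p - 2) x ∂(coneMeasure n p)) ^ 2 ≤
    10000000 * ((2 - 2 * (1 / p)) ^ 2 * (1 - 2 * (1 / p)) ^ 2) *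
      (n * (1 / p) / (1 + n * (1 / p)) ^ 2) *
      (∫ x, powerSum (2 * p - 2) x ∂(coneMeasure n p)) ^ 2 := by
  have hp0 : 0 < p := by linarith
  have hr : 0 ≤ 2 - 2 * (1 / p) := by
    have : 1 / p ≤ 1 := (div_le_one hp0).2 hp
    linarith
  have e : 2 * p - 2 = p * (2 - 2 * (1 / p)) := by field_simp
  have hp2 : 1 / p ≤ 1 / 2 → 2 ≤ p := fun h => (one_div_le_one_div hp0 two_pos).1 h
  refine moment_ratio_le_uniform (by exact_mod_cast hn) (by positivity) ((div_le_one hp0).2 hp)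
    (coneMeasure_real_univ_pos hp0) ?_ ?_ (fun h => integral_powerSum_sq_le hn (hp2 h))
    (fun h => le_integral_powerSum hn (by linarith [hp2 h]))
  · rw [e]
    exact integral_powerSum_coneMeasure hn hp0 hr
  · rw [e]
    exact integral_powerSum_sq_coneMeasure hn hp0 hr

lemma integral_powerSum_pos (hn : 1 ≤ n) (hp : 1 ≤ p) :
    0 < ∫ x, powerSum (2 * p - 2) x ∂(coneMeasure n p) := by
  have hp0 : 0 < p := by linarith
  have hn0 : (0 : ℝ) < n := by exact_mod_cast hn
  have hr : 0 ≤ 2 - 2 * (1 / p) := by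
    have : 1 / p ≤ 1 := (div_le_one hp0).2 hp
    linarith
  have e : 2 * p - 2 = p * (2 - 2 * (1 / p)) := by field_simp
  rw [e, integral_powerSum_coneMeasure hn hp0 hr]
  have := coneMeasure_real_univ_pos (n := n) hp0
  have ha : 0 < 1 / p := by positivity
  have h1 : 0 < 1 / p + (2 - 2 * (1 / p)) := by positivity
  have h2 : 0 < n * (1 / p) + (2 - 2 * (1 / p)) := by positivity
  have h3 : 0 < n * (1 / p) := by positivity
  have := Real.Gamma_pos_of_pos ha
  have := Real.Gamma_pos_of_pos h1
  have := Real.Gamma_pos_of_pos h2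
  have := Real.Gamma_pos_of_pos h3
  positivity

lemma surfaceMeasureSet_eq (hn : 1 ≤ n) (hp : 1 ≤ p) {A : Set (EuclideanSpace ℝ (Fin n))}
    (hA : MeasurableSet A) (hAS : A ⊆ pSphere n p) :
    surfaceMeasureSet n p A = (∫ x in A, √(powerSum (2 * p - 2) x) ∂(coneMeasure n p)) /
      ∫ x, √(powerSum (2 * p - 2) x) ∂(coneMeasure n p) := by
  have hp0 : 0 < p := by linarith
  have hn0 : (0 : ℝ) < n := by exact_mod_cast hn
  set c : NNReal := Measure.addHaarScalarFactor
    (volume : Measure (EuclideanSpace ℝ (Fin (n - 1)))) μH[((n - 1 : ℕ) : ℝ)] with hc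
  have hc0 : (c : ℝ) ≠ 0 := by
    rw [hc]
    exact_mod_cast Measure.addHaarScalarFactor_volume_hausdorffMeasure_ne_zero _
  have hd : ((n - 1 : ℕ) : ℝ) = (n : ℝ) - 1 := by push_cast [hn]; ring
  have key : ∀ B : Set (EuclideanSpace ℝ (Fin n)), MeasurableSet B → B ⊆ pSphere n p →
      (μH[(n : ℝ) - 1] B).toReal =
        n / c * ∫ x in B, √(powerSum (2 * p - 2) x) ∂(coneMeasure n p) := by
    intro B hB hBS
    have h := congrArg ENNReal.toReal (hausdorff_eq_lintegral_coneMeasure hn hp hB hBS)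
    rw [Measure.euclideanHausdorffMeasure_def, Measure.smul_apply, ← hc, hd, ENNReal.smul_def,
      smul_eq_mul, ENNReal.toReal_mul, ENNReal.toReal_mul, ENNReal.toReal_ofReal hn0.le,
      ← integral_eq_lintegral_of_nonneg_ae (.of_forall fun x => Real.sqrt_nonneg _)
        (continuous_sqrt_powerSum hp).aestronglyMeasurable, ENNReal.coe_toReal] at h
    rw [div_mul_eq_mul_div, eq_div_iff hc0, mul_comm, h]
  have hS : ∫ x in pSphere n p, √(powerSum (2 * p - 2) x) ∂(coneMeasure n p) =
      ∫ x, √(powerSum (2 * p - 2) x) ∂(coneMeasure n p) := by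
    rw [Measure.restrict_eq_self_of_ae_mem]
    filter_upwards [ae_coneMeasure hn hp0] with x hx
    exact (mem_pSphere_iff hp0).2 hx
  rw [surfaceMeasureSet, ENNReal.toReal_div, key A hA hAS, key _ (measurableSet_pSphere hp0) subset_rfl,
    hS, mul_div_mul_left]
  positivity

lemma coneMeasureSet_eq (hn : 1 ≤ n) (hp : 1 ≤ p) {A : Set (EuclideanSpace ℝ (Fin n))}
    (hA : MeasurableSet A) (hAS : A ⊆ pSphere n p) :
    coneMeasureSet n p A = (coneMeasure n p).real A / (coneMeasure n p).real univ := by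
  have hp0 : 0 < p := by linarith
  rw [coneMeasureSet, pBall_eq hp0, ← coneMeasure_apply hn hp0 hA hAS, ← coneMeasure_univ hp0.le,
    ENNReal.toReal_div, Measure.real, Measure.real]

/-- The surface and cone measures differ by at most the relative standard deviation of the
density of the squared surface measure. -/
lemma abs_surfaceMeasureSet_sub_coneMeasureSet_le (hn : 1 ≤ n) (hp : 1 ≤ p)
    {A : Set (EuclideanSpace ℝ (Fin n))} (hA : MeasurableSet A) (hAS : A ⊆ pSphere n p) {R : ℝ}
    (hR : 0 ≤ R) (hvar : (∫ x, powerSum (2 * p - 2) x ^ 2 ∂(coneMeasure n p)) *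
      (coneMeasure n p).real univ - (∫ x, powerSum (2 * p - 2) x ∂(coneMeasure n p)) ^ 2 ≤
      R * (∫ x, powerSum (2 * p - 2) x ∂(coneMeasure n p)) ^ 2) :
    |surfaceMeasureSet n p A - coneMeasureSet n p A| ≤ 2 * √R := by
  have hp0 : 0 < p := by linarith
  have := isFiniteMeasure_coneMeasure (n := n) hp0
  have hM := coneMeasure_real_univ_pos (n := n) hp0
  have hI := integral_powerSum_pos hn hp
  have hμ : coneMeasure n p univ ≠ 0 := fun h => by simp [Measure.real, h] at hM
  have : NeZero (coneMeasure n p) := ⟨fun h => hμ (by rw [h]; rfl)⟩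
  rw [surfaceMeasureSet_eq hn hp hA hAS, coneMeasureSet_eq hn hp hA hAS]
  set P := (coneMeasure n p univ)⁻¹ • coneMeasure n p with hP
  have h_integral : ∀ f : EuclideanSpace ℝ (Fin n) → ℝ,
      ∫ x, f x ∂P = ((coneMeasure n p).real univ)⁻¹ * ∫ x, f x ∂(coneMeasure n p) := fun f => by
    rw [hP, integral_smul_measure, ENNReal.toReal_inv, smul_eq_mul, Measure.real]
  have h_setIntegral : ∫ x in A, √(powerSum (2 * p - 2) x) ∂P = ((coneMeasure n p).real univ)⁻¹ *
      ∫ x in A, √(powerSum (2 * p - 2) x) ∂(coneMeasure n p) := by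
    rw [hP, Measure.restrict_smul, integral_smul_measure, ENNReal.toReal_inv, smul_eq_mul, Measure.real]
  have hPA : P.real A = (coneMeasure n p).real A / (coneMeasure n p).real univ := by
    rw [hP, measureReal_def, Measure.smul_apply, smul_eq_mul, ENNReal.toReal_mul, ENNReal.toReal_inv,
      inv_mul_eq_div, Measure.real, Measure.real]
  have h := abs_sqrt_weight_sub_le (P := P) (h := powerSum (2 * p - 2)) (B := n) (R := R)
    (continuous_powerSum (by linarith)).measurable powerSum_nonneg
    (Measure.ae_smul_measure ((ae_coneMeasure hn hp0).mono fun x hx =>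
      powerSum_le_card hp0 hx (by linarith)) _) hR (by rw [h_integral]; positivity) ?_ hA
  · rwa [h_setIntegral, h_integral, mul_div_mul_left _ _ (inv_ne_zero hM.ne'), hPA] at h
  · rw [h_integral, h_integral]
    set M := (coneMeasure n p).real univ
    have : 0 ≤ M⁻¹ ^ 2 := by positivity
    have := mul_le_mul_of_nonneg_left hvar this
    have e : M⁻¹ ^ 2 * M = M⁻¹ := by field_simp
    calc _ = M⁻¹ ^ 2 * M * (∫ x, powerSum (2 * p - 2) x ^ 2 ∂(coneMeasure n p)) -
          M⁻¹ ^ 2 * (∫ x, powerSum (2 * p - 2) x ∂(coneMeasure n p)) ^ 2 := by rw [e]; ring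
      _ ≤ _ := by linarith

end Comparison

/-- There exists an absolute constant `C ∈ (0,∞)` such that for all `n ∈ ℕ` and all
`p ∈ [1,∞)`, the total variation distance between the surface probability measure `σ_p^n`
and the cone probability measure `μ_p^n` on `𝕊_p^{n-1}` satisfies
`sup {|σ_p^n(A) − μ_p^n(A)| : A Borel ⊆ 𝕊_p^{n-1}} ≤ C (1 − 1/p)|1 − 2/p| √(np)/(n+p)`. -/
theorem tv_dist_surface_cone :
    ∃ C : ℝ, 0 < C ∧ ∀ n : ℕ, 1 ≤ n → ∀ p : ℝ, 1 ≤ p →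
      ∀ A : Set (EuclideanSpace ℝ (Fin n)), MeasurableSet A → A ⊆ pSphere n p →
        |surfaceMeasureSet n p A - coneMeasureSet n p A| ≤
          C * (1 - 1 / p) * |1 - 2 / p| * (Real.sqrt (n * p) / (n + p)) := by
  refine ⟨4 * √10000000, by positivity, fun n hn p hp A hA hAS => ?_⟩
  have hp0 : 0 < p := by linarith
  have hn0 : (0 : ℝ) < n := by exact_mod_cast hn
  have hq : 0 ≤ 1 - 1 / p := by
    have : 1 / p ≤ 1 := (div_le_one hp0).2 hp
    linarith
  refine (abs_surfaceMeasureSet_sub_coneMeasureSet_le hn hp hA hAS (by positivity)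
    (variance_powerSum_le hn hp)).trans_eq ?_
  have e : 10000000 * ((2 - 2 * (1 / p)) ^ 2 * (1 - 2 * (1 / p)) ^ 2) *
      (n * (1 / p) / (1 + n * (1 / p)) ^ 2) =
      10000000 * (2 * (1 - 1 / p) * |1 - 2 / p| * (Real.sqrt (n * p) / (n + p))) ^ 2 := by
    rw [mul_pow _ (_ / _), mul_pow _ |_|, sq_abs, div_pow, Real.sq_sqrt (by positivity)]
    field_simp
    ring
  rw [e, Real.sqrt_mul (by norm_num), Real.sqrt_sq (by positivity)]
  ring
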